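/- arXiv:1201.2724 — 2 statements merged into one kernel-verified Lean document; each statement's English description precedes it below -/
import Mathlib

section
/- Let α = 1 − 10^{-10}. For μ ≥ 1, set v_μ = (−cos(π·2^{-μ}), sin(π·2^{-μ})), let s_μ = (sin(π·2^{-μ}) − sin(π·2^{-μ-1})) / (cos(π·2^{-μ-1}) − cos(π·2^{-μ})) be the slope of the segment joining v_μ and v_{μ+1}, let U_μ be the closed triangle with vertices (0,0), v_μ, v_{μ+1}, and let T_μ = {p ∈ U_μ : p ∉ (1 − 2^{-2μ})·P_lac}, where (1 − 2^{-2μ})·P_lac is the dilate of P_lac about the origin by factor 1 − 2^{-2μ}. For a square S ⊂ ℝ², define the rectangle R_{S,μ} = v_μ + L_μ²(S), where L_μ²(ξ, θ) = (−ξ, −s_μ θ). Let 𝔇₂ denote the collection of all closed axis-parallel squares in ℝ² of side length 2^j (j ∈ ℤ) whose centers lie in the lattice 2^{j-10}ℤ², and let Δ = {(ξ, ξ) : ξ ∈ ℝ}. Then there exists C₀* ≥ 1 such that for every C₀ ≥ C₀*, every μ ≥ 1, and every S ∈ 𝔇₂ satisfying C₀S ∩ Δ = ∅, 4C₀S ∩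 Δ ≠ ∅, and α·R_{S,μ} ∩ T_μ ≠ ∅, one has R_{S,μ} ⊆ P_lac. (Here λS and α·R denote concentric dilates.) -/
open Real
open scoped Pointwise

/-- The lacunary polygon `P_lac`: the closed convex hull of the points
`(ε₁ cos(π 2^{-μ}), ε₂ sin(π 2^{-μ}))`, `μ ≥ 1`, `ε₁, ε₂ ∈ {−1,+1}`. -/
noncomputable def Plac : Set (ℝ × ℝ) :=
  closure (convexHull ℝ {p : ℝ × ℝ | ∃ (μ : ℕ) (ε₁ ε₂ : ℝ), 1 ≤ μ ∧
    (ε₁ = 1 ∨ ε₁ = -1) ∧ (ε₂ = 1 ∨ ε₂ = -1) ∧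
    p = (ε₁ * Real.cos (π * 2 ^ (-(μ : ℤ))), ε₂ * Real.sin (π * 2 ^ (-(μ : ℤ))))})

/-- The vertex `v_μ = (−cos(π 2^{-μ}), sin(π 2^{-μ}))` of `P_lac` in the second
quadrant. -/
noncomputable def vtx (μ : ℕ) : ℝ × ℝ :=
  (-Real.cos (π * 2 ^ (-(μ : ℤ))), Real.sin (π * 2 ^ (-(μ : ℤ))))

/-- The edgeSlope `s_μ` of the edge of `P_lac` joining `v_μ` and `v_{μ+1}`. -/
noncomputable def edgeSlope (μ : ℕ) : ℝ :=
  (Real.sin (π * 2 ^ (-(μ : ℤ))) - Real.sin (π * 2 ^ (-(μ : ℤ) - 1))) /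
    (Real.cos (π * 2 ^ (-(μ : ℤ) - 1)) - Real.cos (π * 2 ^ (-(μ : ℤ))))

/-- The closed triangle `U_μ` with vertices `0`, `v_μ`, `v_{μ+1}`. -/
noncomputable def Utri (μ : ℕ) : Set (ℝ × ℝ) :=
  convexHull ℝ {(0 : ℝ × ℝ), vtx μ, vtx (μ + 1)}

/-- The trapezoidal region `T_μ = U_μ ∖ (1 − 2^{-2μ}) P_lac`. -/
noncomputable def Ttrap (μ : ℕ) : Set (ℝ × ℝ) :=
  Utri μ \ ((1 - (2 : ℝ) ^ (-(2 * μ : ℤ))) • Plac)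

/-- The concentric dilate, by factor `lam`, of the square from the grid `𝔇₂`
with side length `2^j` and center `(2^{j-10} m, 2^{j-10} n)`. -/
def gridSquare (j m n : ℤ) (lam : ℝ) : Set (ℝ × ℝ) :=
  Set.Icc ((2 : ℝ) ^ (j - 10) * m - lam * (2 : ℝ) ^ j / 2)
      ((2 : ℝ) ^ (j - 10) * m + lam * (2 : ℝ) ^ j / 2) ×ˢ
  Set.Icc ((2 : ℝ) ^ (j - 10) * n - lam * (2 : ℝ) ^ j / 2)
      ((2 : ℝ) ^ (j - 10) * n + lam * (2 : ℝ) ^ j / 2)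

/-- The diagonal `Δ = {(ξ, ξ)}` in `ℝ²`. -/
def diagΔ : Set (ℝ × ℝ) := {p : ℝ × ℝ | p.1 = p.2}

/-- The concentric dilate, by factor `lam`, of the Whitney rectangle
`R_{S,μ} = v_μ + L_μ²(S)`, where `L_μ²(ξ, θ) = (−ξ, −s_μ θ)` and `S` is the
grid square indexed by `(j, m, n)`; since `L_μ²` is linear, this dilate equals
`v_μ + L_μ²(lam · S)`. -/
noncomputable def whitneyRect (μ : ℕ) (j m n : ℤ) (lam : ℝ) : Set (ℝ × ℝ) :=
  (fun q : ℝ × ℝ => ((vtx μ).1 - q.1, (vtx μ).2 - edgeSlope μ * q.2)) '' gridSquare j m n lam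

/-- The angle `π 2^{-μ}` of the vertex `v_μ`. -/
noncomputable def lacAngle (μ : ℕ) : ℝ := π * 2 ^ (-(μ : ℤ))

lemma lacAngle_succ (μ : ℕ) : lacAngle μ = 2 * lacAngle (μ + 1) := by
  unfold lacAngle
  push_cast
  rw [neg_add, zpow_add₀ (by norm_num)]
  norm_num
  ring

lemma lacAngle_pos (μ : ℕ) : 0 < lacAngle μ := by
  unfold lacAngle
  positivity

lemma lacAngle_one : lacAngle 1 = π / 2 := by
  norm_num [lacAngle]
  ring

lemma lacAngle_two : lacAngle 2 = π / 4 := by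
  have h1 := lacAngle_one
  have h2 := lacAngle_succ 1
  norm_num at h2
  linarith

lemma lacAngle_antitone : Antitone lacAngle :=
  antitone_nat_of_succ_le fun n => by
    linarith [lacAngle_succ n, lacAngle_pos (n + 1)]

lemma vtx_eq (μ : ℕ) : vtx μ = (-Real.cos (lacAngle μ), Real.sin (lacAngle μ)) := rfl

lemma convex_Plac : Convex ℝ Plac := (convex_convexHull ℝ _).closure

lemma signed_vertex_mem_Plac {μ : ℕ} (hμ : 1 ≤ μ) {ε₁ ε₂ : ℝ} (h₁ : ε₁ = 1 ∨ ε₁ = -1)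
    (h₂ : ε₂ = 1 ∨ ε₂ = -1) :
    (ε₁ * Real.cos (lacAngle μ), ε₂ * Real.sin (lacAngle μ)) ∈ Plac :=
  subset_closure (subset_convexHull ℝ _ ⟨μ, ε₁, ε₂, hμ, h₁, h₂, rfl⟩)

lemma vtx_mem_Plac {μ : ℕ} (hμ : 1 ≤ μ) : vtx μ ∈ Plac := by
  simpa [vtx_eq] using signed_vertex_mem_Plac hμ (Or.inr rfl) (Or.inl rfl)

/-- A convex set containing the four corners of a centred rectangle contains the rectangle. -/
lemma Convex.mem_of_corners {K : Set (ℝ × ℝ)} (hK : Convex ℝ K) {X Y x y : ℝ}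
    (h : ∀ ε₁ ε₂ : ℝ, (ε₁ = 1 ∨ ε₁ = -1) → (ε₂ = 1 ∨ ε₂ = -1) → (ε₁ * X, ε₂ * Y) ∈ K)
    (hx : |x| ≤ X) (hy : |y| ≤ Y) : (x, y) ∈ K := by
  have hrow : ∀ ε : ℝ, (ε = 1 ∨ ε = -1) → (x, ε * Y) ∈ K := by
    intro ε hε
    have hc : Convex ℝ {t : ℝ | (t, ε * Y) ∈ K} := by
      intro a ha b hb p q hp hq hpq
      have := hK ha hb hp hq hpq
      simpa [← add_mul, hpq] using this
    exact hc.ordConnected.out (by simpa using h (-1) ε (Or.inr rfl) hε)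
      (by simpa using h 1 ε (Or.inl rfl) hε) (abs_le.mp hx)
  have hc : Convex ℝ {t : ℝ | (x, t) ∈ K} := by
    intro a ha b hb p q hp hq hpq
    have := hK ha hb hp hq hpq
    simpa [← add_mul, hpq] using this
  exact hc.ordConnected.out (by simpa using hrow (-1) (Or.inr rfl))
    (by simpa using hrow 1 (Or.inl rfl)) (abs_le.mp hy)

lemma mem_Plac_of_abs_le {i j : ℕ} (hi : 1 ≤ i) (hj : 1 ≤ j) {t x y : ℝ} (ht₀ : 0 ≤ t)
    (ht₁ : t ≤ 1)
    (hx : |x| ≤ (1 - t) * Real.cos (lacAngle i) + t * Real.cos (lacAngle j))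
    (hy : |y| ≤ (1 - t) * Real.sin (lacAngle i) + t * Real.sin (lacAngle j)) :
    (x, y) ∈ Plac := by
  refine convex_Plac.mem_of_corners (fun ε₁ ε₂ h₁ h₂ => ?_) hx hy
  have := convex_Plac (signed_vertex_mem_Plac hi h₁ h₂) (signed_vertex_mem_Plac hj h₁ h₂)
    (sub_nonneg.mpr ht₁) ht₀ (by ring)
  convert this using 1
  ext <;> simp <;> ring

lemma zero_mem_Plac : (0 : ℝ × ℝ) ∈ Plac := by
  have h := lacAngle_one
  refine mem_Plac_of_abs_le (i := 1) (j := 1) le_rfl le_rfl (t := 0) le_rfl zero_le_one ?_ ?_ <;>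
    simp [h]

lemma seven_tenths_le_cos {b : ℝ} (h₀ : 0 ≤ b) (h₁ : b ≤ π / 4) : 7 / 10 ≤ Real.cos b := by
  have h := Real.cos_le_cos_of_nonneg_of_le_pi h₀ (by linarith [Real.pi_pos]) h₁
  rw [Real.cos_pi_div_four] at h
  have : (7 / 5 : ℝ) ≤ √2 := Real.le_sqrt_of_sq_le (by norm_num)
  linarith

lemma lacAngle_le_pi_div_four {ν : ℕ} (hν : 2 ≤ ν) : lacAngle ν ≤ π / 4 :=
  lacAngle_two ▸ lacAngle_antitone hν

/-- `P_lac` contains an anisotropic box around a slight contraction of the vertex `v_{ν+1}`. -/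
lemma box_near_vtx_subset {ν : ℕ} (hν : 1 ≤ ν) {δ s x y : ℝ} (hδ₀ : 0 ≤ δ)
    (hδ : lacAngle (ν + 1) ^ 2 ≤ 10 * δ) (hs : s * δ ≤ lacAngle (ν + 1) / 3)
    (hx : |x| ≤ (1 - δ) * Real.cos (lacAngle (ν + 1)) + δ / 200)
    (hy : |y| ≤ (1 - δ) * Real.sin (lacAngle (ν + 1)) + s * δ / 200) : (x, y) ∈ Plac := by
  have hpos := lacAngle_pos (ν + 1)
  have hle := lacAngle_le_pi_div_four (Nat.succ_le_succ hν)
  have hdbl := lacAngle_succ ν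
  set b := lacAngle (ν + 1)
  have hcos := seven_tenths_le_cos hpos.le hle
  have hcos1 := Real.cos_le_one b
  have hsin := Real.mul_le_sin hpos.le (by linarith [Real.pi_pos])
  have hsin' := Real.sin_le hpos.le
  have hpi : (5 : ℝ) / 8 ≤ 2 / π := by
    rw [le_div_iff₀ Real.pi_pos]
    linarith [Real.pi_lt_d2]
  have hsb : 5 / 8 * b ≤ Real.sin b := (mul_le_mul_of_nonneg_right hpi hpos.le).trans hsin
  have hsq : Real.sin b ^ 2 ≤ 10 * δ :=
    (pow_le_pow_left₀ (by linarith) hsin' 2).trans hδ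
  refine mem_Plac_of_abs_le (i := ν + 1) (j := ν) (by omega) hν (t := 1 / 40) (by norm_num)
    (by norm_num) (hx.trans ?_) (hy.trans ?_)
  · rw [hdbl, Real.cos_two_mul]
    nlinarith [Real.sin_sq_add_cos_sq b, mul_le_mul_of_nonneg_left hcos hδ₀]
  · rw [hdbl, Real.sin_two_mul]
    nlinarith [mul_nonneg hδ₀ (show 0 ≤ Real.sin b by linarith),
      mul_le_mul_of_nonneg_left hcos (show 0 ≤ Real.sin b by linarith)]

lemma three_quarters_lacAngle_le {μ : ℕ} (hμ : 1 ≤ μ) : 3 / 4 * lacAngle μ ≤ 3 * π / 8 := by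
  have := lacAngle_antitone hμ
  rw [lacAngle_one] at this
  linarith

lemma edgeSlope_eq {μ : ℕ} (hμ : 1 ≤ μ) :
    edgeSlope μ = Real.cos (3 / 4 * lacAngle μ) / Real.sin (3 / 4 * lacAngle μ) ∧
    0 < Real.cos (lacAngle (μ + 1)) - Real.cos (lacAngle μ) ∧
    edgeSlope μ * (Real.cos (lacAngle (μ + 1)) - Real.cos (lacAngle μ)) =
      Real.sin (lacAngle μ) - Real.sin (lacAngle (μ + 1)) := by
  have hdef : edgeSlope μ = (Real.sin (lacAngle μ) - Real.sin (lacAngle (μ + 1))) /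
      (Real.cos (lacAngle (μ + 1)) - Real.cos (lacAngle μ)) := by
    unfold edgeSlope lacAngle
    push_cast
    rw [neg_add, ← sub_eq_add_neg (-(μ : ℤ))]
  have hdbl := lacAngle_succ μ
  have hpos := lacAngle_pos μ
  have hle := three_quarters_lacAngle_le hμ
  have hpi := Real.pi_pos
  have hs₁ : 0 < Real.sin (3 / 4 * lacAngle μ) :=
    Real.sin_pos_of_pos_of_lt_pi (by linarith) (by linarith)
  have hs₂ : 0 < Real.sin (lacAngle μ / 4) :=
    Real.sin_pos_of_pos_of_lt_pi (by linarith) (by linarith)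
  have hsin : Real.sin (lacAngle μ) - Real.sin (lacAngle (μ + 1)) =
      2 * Real.sin (lacAngle μ / 4) * Real.cos (3 / 4 * lacAngle μ) := by
    rw [Real.sin_sub_sin]
    congr 3 <;> linarith
  have hcos : Real.cos (lacAngle (μ + 1)) - Real.cos (lacAngle μ) =
      2 * Real.sin (3 / 4 * lacAngle μ) * Real.sin (lacAngle μ / 4) := by
    have h₁ : (lacAngle (μ + 1) + lacAngle μ) / 2 = 3 / 4 * lacAngle μ := by linarith
    have h₂ : (lacAngle (μ + 1) - lacAngle μ) / 2 = -(lacAngle μ / 4) := by linarith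
    rw [Real.cos_sub_cos, h₁, h₂, Real.sin_neg]
    ring
  have hpos' : 0 < Real.cos (lacAngle (μ + 1)) - Real.cos (lacAngle μ) := by
    rw [hcos]
    positivity
  refine ⟨?_, hpos', ?_⟩
  · rw [hdef, hsin, hcos]
    field_simp
  · rw [hdef, div_mul_cancel₀ _ hpos'.ne']

lemma one_div_four_le_edgeSlope {μ : ℕ} (hμ : 1 ≤ μ) : 1 / 4 ≤ edgeSlope μ := by
  have hpos := lacAngle_pos μ
  have hle := three_quarters_lacAngle_le hμ
  have hpi := Real.pi_pos
  have hs : 0 < Real.sin (3 / 4 * lacAngle μ) :=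
    Real.sin_pos_of_pos_of_lt_pi (by linarith) (by linarith)
  have hc : 1 / 4 ≤ Real.cos (3 / 4 * lacAngle μ) := by
    rw [← Real.sin_pi_div_two_sub]
    refine le_trans ?_ (Real.mul_le_sin (by linarith) (by linarith))
    rw [div_mul_eq_mul_div, le_div_iff₀ hpi]
    linarith
  rw [(edgeSlope_eq hμ).1, le_div_iff₀ hs]
  linarith [Real.sin_le_one (3 / 4 * lacAngle μ)]

lemma edgeSlope_mul_lacAngle_le {μ : ℕ} (hμ : 1 ≤ μ) : edgeSlope μ * lacAngle μ ≤ 4 / 3 := by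
  have hpos := lacAngle_pos μ
  have hle := three_quarters_lacAngle_le hμ
  have hpi := Real.pi_pos
  have hs : 0 < Real.sin (3 / 4 * lacAngle μ) :=
    Real.sin_pos_of_pos_of_lt_pi (by linarith) (by linarith)
  have hc : 0 < Real.cos (3 / 4 * lacAngle μ) :=
    Real.cos_pos_of_mem_Ioo ⟨by linarith, by linarith⟩
  have htan := Real.le_tan (show 0 ≤ 3 / 4 * lacAngle μ by linarith) (by linarith)
  rw [Real.tan_eq_sin_div_cos, le_div_iff₀ hc] at htan
  rw [(edgeSlope_eq hμ).1, div_mul_eq_mul_div, div_le_iff₀ hs]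
  linarith

/-- Relative thickness `2^{-2μ}` of the trapezoidal region `T_μ`. -/
noncomputable def trapDepth (μ : ℕ) : ℝ := (2 : ℝ) ^ (-(2 * μ : ℤ))

lemma trapDepth_pos (μ : ℕ) : 0 < trapDepth μ := by
  unfold trapDepth
  positivity

lemma lacAngle_sq_eq (μ : ℕ) : lacAngle μ ^ 2 = π ^ 2 * trapDepth μ := by
  unfold lacAngle trapDepth
  rw [mul_pow, ← zpow_natCast (2 ^ (-(μ : ℤ)) : ℝ), ← zpow_mul]
  congr 2
  push_cast
  ring

lemma trapDepth_one : trapDepth 1 = 1 / 4 := by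
  norm_num [trapDepth]

lemma trapDepth_le {μ : ℕ} (hμ : 1 ≤ μ) : trapDepth μ ≤ 1 / 4 := by
  have h := pow_le_pow_left₀ (lacAngle_pos μ).le (lacAngle_antitone hμ) 2
  rw [lacAngle_sq_eq, lacAngle_sq_eq, trapDepth_one] at h
  exact le_of_mul_le_mul_left h (by positivity)

lemma edgeSlope_mul_trapDepth_le {μ : ℕ} (hμ : 1 ≤ μ) :
    edgeSlope μ * trapDepth μ ≤ lacAngle μ / 6 := by
  have hpos := lacAngle_pos μ
  have hs := one_div_four_le_edgeSlope hμ
  have h : 9 * trapDepth μ ≤ lacAngle μ ^ 2 := by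
    rw [lacAngle_sq_eq]
    refine mul_le_mul_of_nonneg_right ?_ (trapDepth_pos μ).le
    nlinarith [Real.pi_gt_three]
  have h' := edgeSlope_mul_lacAngle_le hμ
  nlinarith [mul_le_mul_of_nonneg_left h (show 0 ≤ edgeSlope μ by linarith),
    mul_le_mul_of_nonneg_right h' hpos.le]

lemma pi_sq_le_ten : π ^ 2 ≤ 10 := by
  nlinarith [Real.pi_lt_d2, Real.pi_pos]

lemma vtx_box_subset {μ : ℕ} (hμ : 1 ≤ μ) {x y : ℝ}
    (hx : |x| ≤ trapDepth μ / 200) (hy : |y| ≤ edgeSlope μ * trapDepth μ / 200) :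
    (1 - trapDepth μ) • vtx μ + (x, y) ∈ Plac ∧
    (1 - trapDepth μ) • vtx (μ + 1) + (x, y) ∈ Plac := by
  have hδ := trapDepth_pos μ
  have hδ' := trapDepth_le hμ
  have hsδ := edgeSlope_mul_trapDepth_le hμ
  have hpi := Real.pi_pos
  have hform : ∀ ν, (1 - trapDepth μ) • vtx ν + (x, y) =
      (-((1 - trapDepth μ) * Real.cos (lacAngle ν)) + x,
        (1 - trapDepth μ) * Real.sin (lacAngle ν) + y) := by
    intro ν
    ext <;> simp [vtx_eq]
  have hbd : ∀ ν, 1 ≤ ν → |-((1 - trapDepth μ) * Real.cos (lacAngle ν)) + x| ≤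
        (1 - trapDepth μ) * Real.cos (lacAngle ν) + trapDepth μ / 200 ∧
      |(1 - trapDepth μ) * Real.sin (lacAngle ν) + y| ≤
        (1 - trapDepth μ) * Real.sin (lacAngle ν) + edgeSlope μ * trapDepth μ / 200 := by
    intro ν hν
    have h₀ := lacAngle_pos ν
    have h₁ := lacAngle_antitone hν
    rw [lacAngle_one] at h₁
    have hc : 0 ≤ (1 - trapDepth μ) * Real.cos (lacAngle ν) :=
      mul_nonneg (by linarith) (Real.cos_nonneg_of_mem_Icc ⟨by linarith, h₁⟩)
    have hs : 0 ≤ (1 - trapDepth μ) * Real.sin (lacAngle ν) :=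
      mul_nonneg (by linarith) (Real.sin_nonneg_of_nonneg_of_le_pi h₀.le (by linarith))
    constructor
    · refine (abs_add_le _ _).trans ?_
      rw [abs_neg, abs_of_nonneg hc]
      linarith
    · refine (abs_add_le _ _).trans ?_
      rw [abs_of_nonneg hs]
      linarith
  have hle : lacAngle μ ^ 2 ≤ 10 * trapDepth μ := by
    rw [lacAngle_sq_eq]
    exact mul_le_mul_of_nonneg_right pi_sq_le_ten hδ.le
  have hpos := lacAngle_pos (μ + 1)
  constructor
  · rw [hform]
    obtain ⟨h₁, h₂⟩ := hbd μ hμ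
    obtain rfl | ⟨ν, rfl, hν⟩ : μ = 1 ∨ ∃ ν, μ = ν + 1 ∧ 1 ≤ ν := by
      rcases hμ.eq_or_lt with h | h
      · exact Or.inl h.symm
      · exact Or.inr ⟨μ - 1, by omega, by omega⟩
    · have h2 : (7 / 5 : ℝ) ≤ √2 := Real.le_sqrt_of_sq_le (by norm_num)
      refine mem_Plac_of_abs_le (i := 1) (j := 2) le_rfl one_le_two (t := 1 / 40) (by norm_num)
        (by norm_num) (h₁.trans ?_) (h₂.trans ?_)
      · rw [trapDepth_one, lacAngle_one, lacAngle_two, Real.cos_pi_div_two, Real.cos_pi_div_four]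
        linarith
      · rw [lacAngle_one, trapDepth_one] at hsδ
        rw [trapDepth_one, lacAngle_one, lacAngle_two, Real.sin_pi_div_two, Real.sin_pi_div_four]
        linarith [Real.pi_lt_d2]
    · exact box_near_vtx_subset hν hδ.le hle
        (by linarith [lacAngle_pos (ν + 1)]) h₁ h₂
  · rw [hform]
    obtain ⟨h₁, h₂⟩ := hbd (μ + 1) (by omega)
    have hdbl := lacAngle_succ μ
    refine box_near_vtx_subset hμ hδ.le ?_ (by linarith) h₁ h₂
    refine le_trans ?_ hle
    rw [hdbl]
    nlinarith

/-- Points near a slightly contracted edge point stay in `P_lac`. -/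
lemma edge_box_subset {μ : ℕ} (hμ : 1 ≤ μ) {k u x y : ℝ} (hk₀ : 0 < k) (hk : k ≤ trapDepth μ)
    (hu₀ : 0 ≤ u) (hu₁ : u ≤ 1) (hx : |x| ≤ k / 200) (hy : |y| ≤ edgeSlope μ * k / 200) :
    (1 - k) • ((1 - u) • vtx μ + u • vtx (μ + 1)) + (x, y) ∈ Plac := by
  have hδ := trapDepth_pos μ
  set δ := trapDepth μ
  set l := δ / k with hl
  have hl₀ : 0 < l := div_pos hδ hk₀
  have hlk : l * k = δ := div_mul_cancel₀ _ hk₀.ne'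
  have hbox := vtx_box_subset hμ (x := l * x) (y := l * y)
    (by
      rw [abs_mul, abs_of_pos hl₀]
      change _ ≤ δ / 200
      rw [← hlk]
      nlinarith)
    (by
      rw [abs_mul, abs_of_pos hl₀]
      change _ ≤ edgeSlope μ * δ / 200
      rw [← hlk]
      nlinarith)
  have hin := convex_Plac hbox.1 hbox.2 (sub_nonneg.mpr hu₁) hu₀ (by ring)
  have hedge := convex_Plac (vtx_mem_Plac hμ) (vtx_mem_Plac (Nat.le_succ_of_le hμ))
    (sub_nonneg.mpr hu₁) hu₀ (by ring)
  have hr : k / δ ≤ 1 := (div_le_one hδ).mpr hk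
  have := convex_Plac hedge hin (sub_nonneg.mpr hr) (by positivity) (sub_add_cancel _ _)
  convert this using 1
  change _ = (1 - k / δ) • ((1 - u) • vtx μ + u • vtx (μ + 1)) +
    (k / δ) • ((1 - u) • ((1 - δ) • vtx μ + (l * x, l * y)) +
      u • ((1 - δ) • vtx (μ + 1) + (l * x, l * y)))
  clear_value δ
  ext <;> simp [hl] <;> field_simp <;> ring

lemma exists_of_mem_Ttrap {μ : ℕ} (hμ : 1 ≤ μ) {p : ℝ × ℝ} (hp : p ∈ Ttrap μ) :
    ∃ k u : ℝ, 0 ≤ k ∧ k ≤ trapDepth μ ∧ 0 ≤ u ∧ u ≤ 1 ∧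
      p = (1 - k) • ((1 - u) • vtx μ + u • vtx (μ + 1)) := by
  obtain ⟨hU, hP⟩ := hp
  change p ∉ (1 - trapDepth μ) • Plac at hP
  have hδ' := trapDepth_le hμ
  rw [Utri, convexHull_insert (by simp), convexHull_pair, mem_convexJoin] at hU
  obtain ⟨z, rfl, q, hq, hpq⟩ := hU
  obtain ⟨a, u, ha, hu, hau, rfl⟩ := hq
  obtain ⟨k, t, hk, ht, hkt, rfl⟩ := hpq
  obtain rfl : a = 1 - u := by linarith
  obtain rfl : t = 1 - k := by linarith
  refine ⟨k, u, hk, ?_, hu, by linarith, by simp⟩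
  by_contra! hlt
  have hq := convex_Plac (vtx_mem_Plac hμ) (vtx_mem_Plac (Nat.le_succ_of_le hμ)) ha hu hau
  have h1 : 0 < 1 - trapDepth μ := by linarith
  refine hP ⟨_, convex_Plac.smul_mem_of_zero_mem zero_mem_Plac hq
    (t := (1 - k) / (1 - trapDepth μ)) ⟨by positivity, (div_le_one h1).mpr (by linarith)⟩, ?_⟩
  simp only [smul_zero, zero_add]
  rw [smul_smul, mul_div_cancel₀ _ h1.ne']

lemma lt_abs_of_gridSquare_inter_diag_eq_empty {j m n : ℤ} {C : ℝ}
    (h : gridSquare j m n C ∩ diagΔ = ∅) :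
    C * 2 ^ j < |(2 : ℝ) ^ (j - 10) * n - (2 : ℝ) ^ (j - 10) * m| := by
  by_contra! hle
  rw [abs_le] at hle
  set a := (2 : ℝ) ^ (j - 10) * m
  set b := (2 : ℝ) ^ (j - 10) * n
  have hmem : ((a + b) / 2, (a + b) / 2) ∈ gridSquare j m n C ∩ diagΔ := by
    refine ⟨⟨⟨?_, ?_⟩, ⟨?_, ?_⟩⟩, rfl⟩ <;> dsimp only <;> linarith
  rwa [h] at hmem

/-- The Whitney rectangles meeting the trapezoid `T_μ` lie inside `P_lac`,
provided the Whitney constant `C₀` is large enough. -/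
theorem whitney_rectangles_inside_lacunary_polygon :
    ∃ C₀' : ℝ, 1 ≤ C₀' ∧ ∀ C₀ : ℝ, C₀' ≤ C₀ → ∀ μ : ℕ, 1 ≤ μ → ∀ j m n : ℤ,
      gridSquare j m n C₀ ∩ diagΔ = ∅ →
      (gridSquare j m n (4 * C₀) ∩ diagΔ).Nonempty →
      (whitneyRect μ j m n (1 - 10 ^ (-10 : ℤ)) ∩ Ttrap μ).Nonempty →
      whitneyRect μ j m n 1 ⊆ Plac := by
  refine ⟨1001, by norm_num, fun C₀ hC₀ μ hμ j m n hsep _ hmeet => ?_⟩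
  rintro _ ⟨q, ⟨⟨hq₁, hq₂⟩, ⟨hq₃, hq₄⟩⟩, rfl⟩
  obtain ⟨_, ⟨q', ⟨⟨hq₁', hq₂'⟩, ⟨hq₃', hq₄'⟩⟩, rfl⟩, hT⟩ := hmeet
  obtain ⟨k, u, hk₀, hk, hu₀, hu₁, hp⟩ := exists_of_mem_Ttrap hμ hT
  have hgap := lt_abs_of_gridSquare_inter_diag_eq_empty hsep
  have hr : (0 : ℝ) < 2 ^ j := by positivity
  have hαr : 0 < (10 : ℝ) ^ (-10 : ℤ) * 2 ^ j := by positivity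
  have hC : 1001 * (2 : ℝ) ^ j ≤ C₀ * 2 ^ j := by gcongr
  obtain ⟨-, -, hedge⟩ := edgeSlope_eq hμ
  have hs := one_div_four_le_edgeSlope hμ
  have hp₁ := congrArg Prod.fst hp
  have hp₂ := congrArg Prod.snd hp
  simp only [vtx_eq, Prod.smul_mk, Prod.mk_add_mk, smul_eq_mul] at hp₁ hp₂
  set s := edgeSlope μ
  set c := Real.cos (lacAngle μ)
  set d := Real.sin (lacAngle μ)
  have hlevel : s * (q'.2 - q'.1) = k * (d + s * c) := by
    linear_combination s * hp₁ - hp₂ - (1 - k) * u * hedge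
  have hG : 0 ≤ d + s * c := by
    have h₀ := lacAngle_pos μ
    have h₁ := lacAngle_antitone hμ
    rw [lacAngle_one] at h₁
    have hc : 0 ≤ c := Real.cos_nonneg_of_mem_Icc ⟨by linarith, h₁⟩
    have hd : 0 ≤ d := Real.sin_nonneg_of_nonneg_of_le_pi h₀.le (by linarith)
    nlinarith
  have hG' : d + s * c ≤ s * 5 := by
    have hc : c ≤ 1 := Real.cos_le_one _
    have hd : d ≤ 1 := Real.sin_le_one _
    nlinarith
  have hs₀ : 0 < s := by linarith
  have hnonneg : 0 ≤ q'.2 - q'.1 :=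
    nonneg_of_mul_nonneg_right (hlevel ▸ mul_nonneg hk₀ hG) hs₀
  have hupper : q'.2 - q'.1 ≤ 5 * k := by
    refine le_of_mul_le_mul_left ?_ hs₀
    rw [hlevel]
    nlinarith
  have hrk : (2 : ℝ) ^ j ≤ k / 200 := by
    rcases lt_abs.mp hgap with h | h <;> linarith
  have hx : |q'.1 - q.1| ≤ k / 200 := by
    rw [abs_le]
    constructor <;> linarith
  have hy : |s * (q'.2 - q.2)| ≤ s * k / 200 := by
    rw [abs_mul, abs_of_pos hs₀, mul_div_assoc]
    refine mul_le_mul_of_nonneg_left ?_ hs₀.le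
    rw [abs_le]
    constructor <;> linarith
  have := edge_box_subset hμ (by linarith) hk hu₀ hu₁ hx hy
  rw [← hp] at this
  convert this using 1
  ext <;> simp [s]
  ring
end

section
/- There is an absolute constant C < ∞ with the following property. Let ℐ be a finite collection of dyadic intervals in ℝ, and for each I ∈ ℐ let ψ_I : ℝ → ℂ be a continuously differentiable function with ∫_ℝ ψ_I = 0 satisfying |ψ_I(x)| ≤ |I|^{-1/2} (1 + |x − c(I)|/|I|)^{-10} and |ψ_I′(x)| ≤ |I|^{-3/2} (1 + |x − c(I)|/|I|)^{-10} for all x ∈ ℝ. Then for every f ∈ L¹(ℝ), ‖ (Σ_{I∈ℐ} |⟨f, ψ_I⟩|² · 1_I / |I| )^{1/2} ‖_{L^{1,∞}(ℝ)} ≤ C ‖f‖_{L¹(ℝ)}, where ⟨f, ψ_I⟩ = ∫_ℝ f(x) · conj(ψ_I(x)) dx. -/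
open MeasureTheory
open scoped ENNReal

/-- The dyadic interval `[2^j m, 2^j (m+1))` encoded by `p = (j, m)`. -/
def dyadicI (p : ℤ × ℤ) : Set ℝ :=
  Set.Ico ((2 : ℝ) ^ p.1 * p.2) ((2 : ℝ) ^ p.1 * (p.2 + 1))

/-- The length `|I| = 2^j` of the dyadic interval encoded by `p = (j, m)`. -/
noncomputable def dyLen (p : ℤ × ℤ) : ℝ := (2 : ℝ) ^ p.1

/-- The center `c(I) = 2^j (m + 1/2)` of the dyadic interval encoded by `p`. -/
noncomputable def dyCen (p : ℤ × ℤ) : ℝ := (2 : ℝ) ^ p.1 * (p.2 + 1 / 2)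

/-- The weak-`L¹` quasinorm `sup_{λ>0} λ |{ |g| > λ }|`, valued in `ℝ≥0∞`. -/
noncomputable def weakL1 (g : ℝ → ℝ) : ℝ≥0∞ :=
  ⨆ (l : ℝ) (_ : 0 < l), ENNReal.ofReal l * volume {x : ℝ | l < |g x|}

/-- `φ` is an `L²`-normalized mean-zero bump adapted to the dyadic interval encoded by `p`. -/
structure IsAdaptedBump (p : ℤ × ℤ) (φ : ℝ → ℂ) : Prop where
  contDiff : ContDiff ℝ 1 φ
  integral_eq_zero : ∫ x : ℝ, φ x = 0
  norm_le : ∀ x : ℝ, ‖φ x‖ ≤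
    (Real.sqrt (dyLen p))⁻¹ * ((1 + |x - dyCen p| / dyLen p) ^ 10)⁻¹
  norm_deriv_le : ∀ x : ℝ, ‖deriv φ x‖ ≤
    (dyLen p * Real.sqrt (dyLen p))⁻¹ * ((1 + |x - dyCen p| / dyLen p) ^ 10)⁻¹

/-- The unnormalized Poisson kernel centred at `a` with width `q`. -/
noncomputable def poissonBump (a q x : ℝ) : ℝ := (1 + ((x - a) / q) ^ 2)⁻¹

/-! ### The Poisson kernel -/

lemma poissonBump_nonneg (a q x : ℝ) : 0 ≤ poissonBump a q x := by
  unfold poissonBump; positivity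

lemma poissonBump_comm (a q x : ℝ) : poissonBump a q x = poissonBump x q a := by
  unfold poissonBump
  rw [← neg_sub a x, neg_div, neg_sq]

lemma integrable_poissonBump (a : ℝ) {q : ℝ} (hq : 0 < q) :
    Integrable (poissonBump a q) := by
  have h := (integrable_inv_one_add_sq.comp_div hq.ne').comp_sub_right a
  exact h

lemma integral_poissonBump (a : ℝ) {q : ℝ} (hq : 0 < q) :
    ∫ x, poissonBump a q x = q * Real.pi := by
  have h1 := integral_sub_right_eq_self (μ := volume) (fun x : ℝ => (1 + (x / q) ^ 2)⁻¹) a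
  have h2 := Measure.integral_comp_div (fun x : ℝ => (1 + x ^ 2)⁻¹) q
  rw [integral_univ_inv_one_add_sq, abs_of_pos hq] at h2
  exact h1.trans h2

lemma inv_one_add_sq_le_poissonBump (a x : ℝ) {q : ℝ} (hq : 0 < q) :
    ((1 + |x - a| / q) ^ 2)⁻¹ ≤ poissonBump a q x := by
  unfold poissonBump
  have h : ((x - a) / q) ^ 2 = (|x - a| / q) ^ 2 := by
    rw [div_pow, div_pow, sq_abs]
  rw [h]
  have : 0 ≤ |x - a| / q := by positivity
  gcongr
  nlinarith

lemma measurable_poissonBump (a q : ℝ) : Measurable (poissonBump a q) := by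
  unfold poissonBump; fun_prop

/-! ### Dyadic intervals -/

lemma dyLen_pos (p : ℤ × ℤ) : 0 < dyLen p := by unfold dyLen; positivity

lemma measurableSet_dyadicI (p : ℤ × ℤ) : MeasurableSet (dyadicI p) := measurableSet_Ico

lemma volume_dyadicI (p : ℤ × ℤ) : volume (dyadicI p) = ENNReal.ofReal (dyLen p) := by
  unfold dyadicI dyLen
  rw [Real.volume_Ico]
  congr 1
  ring

lemma volume_real_dyadicI (p : ℤ × ℤ) : volume.real (dyadicI p) = dyLen p := by
  rw [Measure.real, volume_dyadicI, ENNReal.toReal_ofReal (dyLen_pos p).le]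

lemma abs_sub_dyCen_le {p : ℤ × ℤ} {x : ℝ} (hx : x ∈ dyadicI p) :
    |x - dyCen p| ≤ dyLen p / 2 := by
  unfold dyadicI at hx
  unfold dyCen dyLen
  obtain ⟨h1, h2⟩ := hx
  rw [abs_le]
  constructor <;> nlinarith

lemma mem_dyadicI_iff {p : ℤ × ℤ} {x : ℝ} : x ∈ dyadicI p ↔ ⌊x / 2 ^ p.1⌋ = p.2 := by
  have h : (0 : ℝ) < 2 ^ p.1 := by positivity
  rw [Int.floor_eq_iff, le_div_iff₀ h, div_lt_iff₀ h, mul_comm, mul_comm (_ + 1)]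
  rfl

lemma eq_of_mem_dyadicI {p q : ℤ × ℤ} {x : ℝ} (hp : x ∈ dyadicI p) (hq : x ∈ dyadicI q)
    (h : p.1 = q.1) : p = q := by
  rw [mem_dyadicI_iff] at hp hq
  exact Prod.ext h (by rw [← hp, ← hq, h])

lemma dyadicI_subset_of_mem {p q : ℤ × ℤ} {x : ℝ} (hp : x ∈ dyadicI p) (hq : x ∈ dyadicI q)
    (h : p.1 ≤ q.1) : dyadicI p ⊆ dyadicI q := by
  obtain ⟨k, hk⟩ := Int.le.dest h
  have hpos : (0 : ℝ) < 2 ^ p.1 := by positivity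
  have e : (2 : ℝ) ^ q.1 = 2 ^ p.1 * (2 ^ k : ℕ) := by
    rw [← hk, zpow_add₀ two_ne_zero]; simp
  unfold dyadicI at *
  rw [e] at hq ⊢
  obtain ⟨p1, p2⟩ := hp
  obtain ⟨q1, q2⟩ := hq
  rw [mul_assoc] at q1 q2
  have a1 : ((2 ^ k : ℕ) : ℝ) * q.2 < p.2 + 1 := lt_of_mul_lt_mul_left (q1.trans_lt p2) hpos.le
  have a2 : (p.2 : ℝ) < ((2 ^ k : ℕ) : ℝ) * (q.2 + 1) :=
    lt_of_mul_lt_mul_left (p1.trans_lt q2) hpos.le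
  have b1 : ((2 ^ k : ℕ) : ℤ) * q.2 ≤ p.2 := by
    rw [← Int.lt_add_one_iff]; exact_mod_cast a1
  have b2 : p.2 + 1 ≤ ((2 ^ k : ℕ) : ℤ) * (q.2 + 1) := by
    rw [Int.add_one_le_iff]; exact_mod_cast a2
  rw [mul_assoc, mul_assoc]
  apply Set.Ico_subset_Ico
  · gcongr; exact_mod_cast b1
  · gcongr; exact_mod_cast b2

/-! ### Sums over scales -/

lemma sum_pow_natAbs_sub_le {r : ℝ} (h0 : 0 ≤ r) (h1 : r < 1) (s : Finset ℤ) (i : ℤ) :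
    ∑ j ∈ s, r ^ (j - i).natAbs ≤ 2 * (1 - r)⁻¹ := by
  have hs : Summable (fun n : ℕ => r ^ n) := summable_geometric_of_lt_one h0 h1
  have key : ∀ t : Finset ℤ, ∀ g : ℤ → ℤ, Set.InjOn (fun j => (g j).natAbs) t →
      ∑ j ∈ t, r ^ (g j).natAbs ≤ (1 - r)⁻¹ := by
    intro t g hg
    rw [← tsum_geometric_of_lt_one h0 h1,
      ← Finset.sum_image (f := fun n => r ^ n) hg]
    exact hs.sum_le_tsum _ (fun _ _ => by positivity)
  rw [← Finset.sum_filter_add_sum_filter_not s (fun j => i ≤ j), two_mul]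
  refine add_le_add (key _ (fun j => j - i) ?_) (key _ (fun j => j - i) ?_)
  · intro a ha b hb h
    simp at ha hb h
    omega
  · intro a ha b hb h
    simp at ha hb h
    omega

lemma sum_scale_decay_le (s : Finset ℤ) {d : ℝ} (hd : 0 < d) :
    ∑ j ∈ s, (((2 : ℝ) ^ j) ^ 2)⁻¹ * ((1 + d / 2 ^ j) ^ 3)⁻¹ ≤ 16 * (d ^ 2)⁻¹ := by
  obtain ⟨n, hn1, hn2⟩ := exists_mem_Ico_zpow hd (one_lt_two (α := ℝ))
  have key : ∀ j ∈ s, (((2 : ℝ) ^ j) ^ 2)⁻¹ * ((1 + d / 2 ^ j) ^ 3)⁻¹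
      ≤ 4 * (d ^ 2)⁻¹ * (1 / 2 : ℝ) ^ (j - n).natAbs := by
    intro j _
    have hL : (0 : ℝ) < 2 ^ j := by positivity
    have hN : (0 : ℝ) < 2 ^ n := by positivity
    rw [zpow_add_one₀ two_ne_zero] at hn2
    rcases le_total n j with h | h
    · obtain ⟨k, rfl⟩ := Int.le.dest h
      have e : (n + k - n : ℤ).natAbs = k := by simp
      rw [e, zpow_add₀ two_ne_zero, zpow_natCast] at *
      have hk : (1 : ℝ) ≤ 2 ^ k := one_le_pow₀ one_le_two
      have h1 : ((1 + d / (2 ^ n * 2 ^ k)) ^ 3)⁻¹ ≤ 1 := by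
        apply inv_le_one_of_one_le₀
        apply one_le_pow₀
        have : 0 ≤ d / (2 ^ n * 2 ^ k) := by positivity
        linarith
      calc _ ≤ (((2 : ℝ) ^ n * 2 ^ k) ^ 2)⁻¹ * 1 := by gcongr
        _ ≤ _ := by
          rw [one_div, inv_pow, mul_one, mul_assoc, ← mul_inv, inv_le_iff_one_le_mul₀ (by positivity)]
          rw [mul_comm, ← mul_assoc, ← div_eq_mul_inv, one_le_div (by positivity)]
          have : d ^ 2 ≤ ((2 : ℝ) ^ n * 2) ^ 2 := by gcongr
          have h5 : ((2 : ℝ) ^ n)^2 * 2 ^ k ≤ ((2 : ℝ) ^ n)^2 * (2 ^ k) ^ 2 := by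
            gcongr; nlinarith
          nlinarith
    · obtain ⟨k, rfl⟩ := Int.le.dest h
      have e : (j - (j + k) : ℤ).natAbs = k := by simp
      rw [e, zpow_add₀ two_ne_zero, zpow_natCast] at *
      have h1 : ((1 + d / 2 ^ j) ^ 3)⁻¹ ≤ ((d / 2 ^ j) ^ 3)⁻¹ := by
        gcongr; linarith
      calc _ ≤ (((2 : ℝ) ^ j) ^ 2)⁻¹ * ((d / 2 ^ j) ^ 3)⁻¹ := by gcongr
        _ = (d ^ 2)⁻¹ * (2 ^ j / d) := by field_simp
        _ ≤ (d ^ 2)⁻¹ * (1 / 2 ^ k) := by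
          gcongr ?_ * ?_
          rw [div_le_div_iff₀ hd (by positivity)]; linarith
        _ ≤ _ := by
          rw [one_div, one_div, inv_pow]
          have : 0 ≤ (d ^ 2)⁻¹ * ((2 : ℝ) ^ k)⁻¹ := by positivity
          nlinarith
  calc _ ≤ ∑ j ∈ s, 4 * (d ^ 2)⁻¹ * (1 / 2 : ℝ) ^ (j - n).natAbs := Finset.sum_le_sum key
    _ ≤ 4 * (d ^ 2)⁻¹ * (2 * (1 - 1 / 2)⁻¹) := by
      rw [← Finset.mul_sum]
      gcongr
      exact sum_pow_natAbs_sub_le (by norm_num) (by norm_num) s n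
    _ = _ := by ring

/-! ### The Boas–Bellman inequality -/

lemma sum_norm_inner_sq_le_of_gram {ι E : Type*} [NormedAddCommGroup E] [InnerProductSpace ℂ E]
    (s : Finset ι) (v : ι → E) {A : ℝ} (hA0 : 0 ≤ A)
    (hA : ∀ i ∈ s, ∑ j ∈ s, ‖inner ℂ (v i) (v j)‖ ≤ A) (x : E) :
    ∑ i ∈ s, ‖inner ℂ (v i) x‖ ^ 2 ≤ A * ‖x‖ ^ 2 := by
  set a : ι → ℂ := fun i => inner ℂ (v i) x with ha
  set y : E := ∑ i ∈ s, a i • v i with hy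
  set S : ℝ := ∑ i ∈ s, ‖a i‖ ^ 2 with hS
  have hS0 : 0 ≤ S := by positivity
  have h1 : inner ℂ y x = (S : ℂ) := by
    rw [hy, sum_inner, hS]
    push_cast
    refine Finset.sum_congr rfl fun i _ => ?_
    rw [inner_smul_left, ← Complex.conj_mul']
  have h2 : S ≤ ‖y‖ * ‖x‖ := by
    have := norm_inner_le_norm (𝕜 := ℂ) y x
    rwa [h1, Complex.norm_real, Real.norm_of_nonneg hS0] at this
  have h3 : ‖y‖ ^ 2 ≤ A * S := by
    have e : ‖y‖ ^ 2 = ‖(inner ℂ y y : ℂ)‖ := by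
      rw [inner_self_eq_norm_sq_to_K]; simp
    have e2 : (inner ℂ y y : ℂ) =
        ∑ i ∈ s, ∑ j ∈ s, (starRingEnd ℂ) (a i) * (a j * inner ℂ (v i) (v j)) := by
      rw [hy, sum_inner]
      refine Finset.sum_congr rfl fun i _ => ?_
      rw [inner_sum]
      refine Finset.sum_congr rfl fun j _ => ?_
      rw [inner_smul_left, inner_smul_right]
    have sym : ∑ i ∈ s, ∑ j ∈ s, ‖a j‖ ^ 2 * ‖inner ℂ (v i) (v j)‖ =
        ∑ i ∈ s, ∑ j ∈ s, ‖a i‖ ^ 2 * ‖inner ℂ (v i) (v j)‖ := by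
      rw [Finset.sum_comm]
      refine Finset.sum_congr rfl fun i _ => Finset.sum_congr rfl fun j _ => ?_
      rw [norm_inner_symm (v j) (v i)]
    have diag : ∑ i ∈ s, ∑ j ∈ s, ‖a i‖ ^ 2 * ‖inner ℂ (v i) (v j)‖ ≤ A * S := by
      rw [hS, Finset.mul_sum]
      refine Finset.sum_le_sum fun i hi => ?_
      rw [← Finset.mul_sum, mul_comm A]
      gcongr
      exact hA i hi
    rw [e, e2]
    calc _ ≤ ∑ i ∈ s, ∑ j ∈ s, ‖(starRingEnd ℂ) (a i) * (a j * inner ℂ (v i) (v j))‖ :=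
          (norm_sum_le _ _).trans (Finset.sum_le_sum fun i _ => norm_sum_le _ _)
      _ ≤ ∑ i ∈ s, ∑ j ∈ s, (1 / 2 * (‖a i‖ ^ 2 * ‖inner ℂ (v i) (v j)‖) +
            1 / 2 * (‖a j‖ ^ 2 * ‖inner ℂ (v i) (v j)‖)) := by
          refine Finset.sum_le_sum fun i _ => Finset.sum_le_sum fun j _ => ?_
          rw [norm_mul, norm_mul, RCLike.norm_conj]
          nlinarith [mul_nonneg (sq_nonneg (‖a i‖ - ‖a j‖)) (norm_nonneg (inner ℂ (v i) (v j)))]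
      _ = ∑ i ∈ s, ∑ j ∈ s, ‖a i‖ ^ 2 * ‖inner ℂ (v i) (v j)‖ := by
          simp only [Finset.sum_add_distrib, ← Finset.mul_sum, sym]
          ring
      _ ≤ A * S := diag
  rcases hS0.eq_or_lt with h | h
  · rw [← h]
    positivity
  · have : S * S ≤ (A * ‖x‖ ^ 2) * S := by
      calc S * S ≤ (‖y‖ * ‖x‖) * (‖y‖ * ‖x‖) := by gcongr
        _ = ‖y‖ ^ 2 * ‖x‖ ^ 2 := by ring
        _ ≤ A * S * ‖x‖ ^ 2 := by gcongr
        _ = _ := by ring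
    exact le_of_mul_le_mul_right this h

/-! ### Estimates for adapted bumps -/

namespace IsAdaptedBump

variable {p r : ℤ × ℤ} {φ χ : ℝ → ℂ}

lemma norm_le_poissonBump (h : IsAdaptedBump p φ) (x : ℝ) :
    ‖φ x‖ ≤ (Real.sqrt (dyLen p))⁻¹ * poissonBump (dyCen p) (dyLen p) x := by
  refine (h.norm_le x).trans ?_
  gcongr
  refine le_trans ?_ (inv_one_add_sq_le_poissonBump (dyCen p) x (dyLen_pos p))
  have := dyLen_pos p
  have h1 : 1 ≤ 1 + |x - dyCen p| / dyLen p := by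
    have : 0 ≤ |x - dyCen p| / dyLen p := by positivity
    linarith
  gcongr
  norm_num

lemma integrable (h : IsAdaptedBump p φ) : Integrable φ :=
  ((integrable_poissonBump (dyCen p) (dyLen_pos p)).const_mul _).mono'
    h.contDiff.continuous.aestronglyMeasurable (ae_of_all _ h.norm_le_poissonBump)

lemma norm_le_bound (h : IsAdaptedBump p φ) (x : ℝ) : ‖φ x‖ ≤ (Real.sqrt (dyLen p))⁻¹ := by
  refine (h.norm_le_poissonBump x).trans (mul_le_of_le_one_right (by positivity) ?_)
  unfold poissonBump
  exact inv_le_one_of_one_le₀ (by nlinarith [sq_nonneg ((x - dyCen p) / dyLen p)])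

lemma memLp_two (h : IsAdaptedBump p φ) : MemLp φ 2 := by
  rw [memLp_two_iff_integrable_sq_norm h.contDiff.continuous.aestronglyMeasurable]
  refine (h.integrable.norm.const_mul (Real.sqrt (dyLen p))⁻¹).mono'
    (by have := h.contDiff.continuous; fun_prop) (ae_of_all _ fun x => ?_)
  rw [Real.norm_of_nonneg (by positivity), sq]
  gcongr
  exact h.norm_le_bound x

lemma norm_sub_le_of_forall_mem_uIcc (h : IsAdaptedBump p φ) {a x B : ℝ}
    (hB : ∀ y ∈ Set.uIcc a x, ((1 + |y - dyCen p| / dyLen p) ^ 10)⁻¹ ≤ B) :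
    ‖φ x - φ a‖ ≤ (dyLen p * Real.sqrt (dyLen p))⁻¹ * B * |x - a| := by
  have hL := dyLen_pos p
  refine Convex.norm_image_sub_le_of_norm_deriv_le (𝕜 := ℝ) (s := Set.uIcc a x)
    (fun y _ => (h.contDiff.differentiable one_ne_zero).differentiableAt)
    (fun y hy => (h.norm_deriv_le y).trans ?_) (convex_uIcc a x)
    Set.left_mem_uIcc Set.right_mem_uIcc
  gcongr
  exact hB y hy

lemma norm_sub_le (h : IsAdaptedBump p φ) {a x δ : ℝ} (hδ : 0 < δ) (hδL : δ ≤ dyLen p) :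
    ‖φ x - φ a‖ ≤ (dyLen p * Real.sqrt (dyLen p))⁻¹ *
      (((1 + |a - dyCen p| / dyLen p) ^ 2)⁻¹ * (1 + |x - a| / δ) ^ 2) * |x - a| := by
  have hL := dyLen_pos p
  refine h.norm_sub_le_of_forall_mem_uIcc fun y hy => ?_
  set D := |a - dyCen p| / dyLen p with hD
  set E := |y - dyCen p| / dyLen p with hE
  set u := |x - a| / δ with hu
  have D0 : 0 ≤ D := by positivity
  have E0 : 0 ≤ E := by positivity
  have u0 : 0 ≤ u := by positivity
  have key : 1 + D ≤ (1 + E) * (1 + u) := by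
    have hya : |y - a| ≤ |x - a| := Set.abs_sub_left_of_mem_uIcc hy
    have : D ≤ E + u := by
      calc D ≤ (|y - dyCen p| + |y - a|) / dyLen p := by
            rw [hD]; gcongr; rw [abs_sub_comm y a, add_comm]; exact abs_sub_le _ _ _
        _ = E + |y - a| / dyLen p := by rw [add_div]
        _ ≤ E + u := by rw [hu]; gcongr
    nlinarith [mul_nonneg E0 u0]
  calc ((1 + E) ^ 10)⁻¹ ≤ ((1 + E) ^ 2)⁻¹ := by
        gcongr
        · linarith
        · norm_num
    _ ≤ _ := by
      rw [inv_mul_eq_div, le_div_iff₀ (by positivity), inv_mul_le_iff₀ (by positivity), ← mul_pow]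
      gcongr

lemma norm_integral_mul_conj_le (hφ : IsAdaptedBump p φ) (hχ : IsAdaptedBump r χ)
    (hle : dyLen r ≤ dyLen p) :
    ‖∫ x, φ x * (starRingEnd ℂ) (χ x)‖ ≤ Real.pi *
      ((dyLen r * Real.sqrt (dyLen r)) / (dyLen p * Real.sqrt (dyLen p))) *
      poissonBump (dyCen p) (dyLen p) (dyCen r) := by
  have hp := dyLen_pos p
  have hr := dyLen_pos r
  have hχc : Integrable (fun x => (starRingEnd ℂ) (χ x)) := by
    exact Complex.conjCLE.toContinuousLinearMap.integrable_comp hχ.integrable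
  have hz : ∫ x, (starRingEnd ℂ) (χ x) = 0 := by
    rw [integral_conj, hχ.integral_eq_zero, map_zero]
  have hi : Integrable (fun x => φ x * (starRingEnd ℂ) (χ x)) :=
    hχc.bdd_mul hφ.contDiff.continuous.aestronglyMeasurable (ae_of_all _ hφ.norm_le_bound)
  have e : ∫ x, φ x * (starRingEnd ℂ) (χ x) =
      ∫ x, (φ x - φ (dyCen r)) * (starRingEnd ℂ) (χ x) := by
    simp_rw [sub_mul]
    rw [integral_sub hi (hχc.const_mul _), integral_const_mul, hz, mul_zero, sub_zero]
  set K : ℝ := (dyLen p * Real.sqrt (dyLen p))⁻¹ *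
    ((1 + |dyCen r - dyCen p| / dyLen p) ^ 2)⁻¹ * (dyLen r * (Real.sqrt (dyLen r))⁻¹) with hK
  have pt : ∀ x, ‖(φ x - φ (dyCen r)) * (starRingEnd ℂ) (χ x)‖ ≤
      K * poissonBump (dyCen r) (dyLen r) x := by
    intro x
    rw [norm_mul, RCLike.norm_conj]
    refine (mul_le_mul (hφ.norm_sub_le hr hle) (hχ.norm_le x) (norm_nonneg _)
      (by positivity)).trans ?_
    refine le_trans ?_ (mul_le_mul_of_nonneg_left
      (inv_one_add_sq_le_poissonBump (dyCen r) x hr) (by positivity))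
    set u := |x - dyCen r| / dyLen r with hu
    have hux : |x - dyCen r| = u * dyLen r := by rw [hu]; field_simp
    have u0 : 0 ≤ u := by positivity
    rw [hux]
    have hh : (1 + u) ^ 2 * u * ((1 + u) ^ 10)⁻¹ ≤ ((1 + u) ^ 2)⁻¹ := by
      rw [← div_eq_mul_inv, ← one_div, div_le_div_iff₀ (by positivity) (by positivity)]
      have h1 : (1 : ℝ) ≤ 1 + u := by linarith
      calc (1 + u) ^ 2 * u * (1 + u) ^ 2 ≤ (1 + u) ^ 2 * (1 + u) * (1 + u) ^ 2 := by
            gcongr; linarith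
        _ = (1 + u) ^ 5 := by ring
        _ ≤ (1 + u) ^ 10 := pow_le_pow_right₀ h1 (by norm_num)
        _ = 1 * (1 + u) ^ 10 := by ring
    calc _ = K * ((1 + u) ^ 2 * u * ((1 + u) ^ 10)⁻¹) := by rw [hK]; ring
      _ ≤ _ := by gcongr
  rw [e]
  calc _ ≤ ∫ x, K * poissonBump (dyCen r) (dyLen r) x :=
        norm_integral_le_of_norm_le ((integrable_poissonBump _ hr).const_mul _)
          (ae_of_all _ pt)
    _ = ((1 + |dyCen r - dyCen p| / dyLen p) ^ 2)⁻¹ * (Real.pi *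
      ((dyLen r * Real.sqrt (dyLen r)) / (dyLen p * Real.sqrt (dyLen p)))) := by
        rw [integral_const_mul, integral_poissonBump _ hr, hK]
        have : dyLen r * (Real.sqrt (dyLen r))⁻¹ = Real.sqrt (dyLen r) := by
          rw [← div_eq_mul_inv, Real.div_sqrt]
        rw [this]
        ring
    _ ≤ _ := by
        rw [mul_comm]
        gcongr
        exact inv_one_add_sq_le_poissonBump _ _ hp

end IsAdaptedBump

/-! ### Almost orthogonality and the `L²` bound -/

lemma poissonBump_dyCen_le {p : ℤ × ℤ} {a M y : ℝ} (hM : dyLen p ≤ M) (hy : y ∈ dyadicI p) :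
    poissonBump a M (dyCen p) ≤ 2 * poissonBump a M y := by
  have hp := dyLen_pos p
  have hM0 : 0 < M := hp.trans_le hM
  unfold poissonBump
  set u := (dyCen p - a) / M with hu
  set v := (y - dyCen p) / M with hv
  have e : (y - a) / M = u + v := by rw [hu, hv]; ring
  have hv1 : |v| ≤ 1 / 2 := by
    rw [hv, abs_div, abs_of_pos hM0, div_le_iff₀ hM0]
    linarith [abs_sub_dyCen_le hy]
  have hv2 : v ^ 2 ≤ 1 / 4 := by rw [← sq_abs]; nlinarith [abs_nonneg v]
  rw [e, ← div_eq_mul_inv, ← one_div, div_le_div_iff₀ (by positivity) (by positivity)]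
  nlinarith [sq_nonneg (u - v)]

lemma sum_poissonBump_dyCen_le (s : Finset (ℤ × ℤ)) {j : ℤ} (hs : ∀ r ∈ s, r.1 = j) (a : ℝ)
    {M : ℝ} (hM : (2 : ℝ) ^ j ≤ M) :
    2 ^ j * ∑ r ∈ s, poissonBump a M (dyCen r) ≤ 2 * (M * Real.pi) := by
  have hM0 : 0 < M := lt_of_lt_of_le (by positivity) hM
  have hker := integrable_poissonBump a hM0
  have hlen : ∀ r ∈ s, dyLen r = 2 ^ j := fun r hr => by rw [dyLen, hs r hr]
  have hdisj : (s : Set (ℤ × ℤ)).Pairwise (Function.onFun Disjoint dyadicI) := by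
    intro r hr t ht hne
    refine Set.disjoint_left.2 fun x hx hx' => hne ?_
    exact eq_of_mem_dyadicI hx hx' ((hs r hr).trans (hs t ht).symm)
  have key : ∀ r ∈ s, 2 ^ j * poissonBump a M (dyCen r) ≤
      ∫ y in dyadicI r, 2 * poissonBump a M y := by
    intro r hr
    have h1 : ∫ _ in dyadicI r, poissonBump a M (dyCen r) = 2 ^ j * poissonBump a M (dyCen r) := by
      rw [setIntegral_const, volume_real_dyadicI, hlen r hr, smul_eq_mul]
    rw [← h1]
    refine setIntegral_mono_on (integrableOn_const ?_) (hker.const_mul 2).integrableOn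
      (measurableSet_dyadicI r) fun y hy => poissonBump_dyCen_le ((hlen r hr).trans_le hM) hy
    rw [volume_dyadicI]; exact ENNReal.ofReal_ne_top
  rw [Finset.mul_sum]
  refine (Finset.sum_le_sum key).trans ?_
  rw [← integral_biUnion_finset s (fun r _ => measurableSet_dyadicI r) hdisj
    (fun r _ => (hker.const_mul 2).integrableOn)]
  refine (setIntegral_le_integral (hker.const_mul 2) (ae_of_all _ fun x => ?_)).trans ?_
  · have := poissonBump_nonneg a M x
    simp only [Pi.zero_apply]; positivity
  · rw [integral_const_mul, integral_poissonBump a hM0]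

lemma dyLen_mul_sqrt_div {p r : ℤ × ℤ} {n : ℕ} (h : p.1 = r.1 + n) :
    (dyLen r * Real.sqrt (dyLen r)) / (dyLen p * Real.sqrt (dyLen p)) =
      (1 / 2) ^ n * (Real.sqrt 2)⁻¹ ^ n := by
  have e : dyLen p = dyLen r * 2 ^ n := by
    unfold dyLen; rw [h, zpow_add₀ two_ne_zero, zpow_natCast]
  have e2 : Real.sqrt (2 ^ n) = Real.sqrt 2 ^ n := by
    rw [← Real.sqrt_sq (by positivity : 0 ≤ Real.sqrt 2 ^ n), ← pow_mul, mul_comm, pow_mul,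
      Real.sq_sqrt zero_le_two]
  have hr := dyLen_pos r
  have hs : 0 < Real.sqrt (dyLen r) := Real.sqrt_pos.2 hr
  rw [e, Real.sqrt_mul hr.le, e2, one_div, inv_pow, inv_pow]
  field_simp

lemma norm_integral_conj_comm (φ χ : ℝ → ℂ) :
    ‖∫ x, φ x * (starRingEnd ℂ) (χ x)‖ = ‖∫ x, χ x * (starRingEnd ℂ) (φ x)‖ := by
  rw [← RCLike.norm_conj, ← integral_conj]
  simp [mul_comm]

lemma IsAdaptedBump.norm_gram_le {p r : ℤ × ℤ} {φ χ : ℝ → ℂ} (hφ : IsAdaptedBump p φ)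
    (hχ : IsAdaptedBump r χ) :
    ‖∫ x, φ x * (starRingEnd ℂ) (χ x)‖ ≤ Real.pi *
      ((1 / 2) ^ (r.1 - p.1).natAbs * (Real.sqrt 2)⁻¹ ^ (r.1 - p.1).natAbs) *
      poissonBump (dyCen p) (2 ^ max p.1 r.1) (dyCen r) := by
  rcases le_total r.1 p.1 with h | h
  · have := hφ.norm_integral_mul_conj_le hχ (zpow_le_zpow_right₀ one_le_two h)
    rw [max_eq_left h]
    rwa [dyLen_mul_sqrt_div (n := (r.1 - p.1).natAbs) (by omega), dyLen] at this
  · have := hχ.norm_integral_mul_conj_le hφ (zpow_le_zpow_right₀ one_le_two h)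
    rw [max_eq_right h]
    rwa [dyLen_mul_sqrt_div (n := (r.1 - p.1).natAbs) (by omega), dyLen,
      poissonBump_comm, norm_integral_conj_comm] at this

/-- The constant in the `L²` bound for families of adapted bumps. -/
noncomputable def besselConst : ℝ := 2 * Real.pi ^ 2 * (2 * (1 - (Real.sqrt 2)⁻¹)⁻¹)

lemma inv_sqrt_two_lt_one : (Real.sqrt 2)⁻¹ < 1 :=
  inv_lt_one_of_one_lt₀ (Real.lt_sqrt_of_sq_lt (by norm_num))

lemma besselConst_pos : 0 < besselConst := by
  have := inv_sqrt_two_lt_one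
  have h : 0 < 1 - (Real.sqrt 2)⁻¹ := by linarith
  unfold besselConst
  positivity

lemma sum_norm_gram_le {ℐ : Finset (ℤ × ℤ)} {ψ : ℤ × ℤ → ℝ → ℂ}
    (hψ : ∀ p ∈ ℐ, IsAdaptedBump p (ψ p)) {p : ℤ × ℤ} (hp : p ∈ ℐ) :
    ∑ r ∈ ℐ, ‖∫ x, ψ p x * (starRingEnd ℂ) (ψ r x)‖ ≤ besselConst := by
  rw [← Finset.sum_fiberwise_of_maps_to (t := ℐ.image Prod.fst) (g := Prod.fst)
    (fun r hr => Finset.mem_image_of_mem _ hr)]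
  have key : ∀ j ∈ ℐ.image Prod.fst,
      ∑ r ∈ ℐ with r.1 = j, ‖∫ x, ψ p x * (starRingEnd ℂ) (ψ r x)‖ ≤
        2 * Real.pi ^ 2 * (Real.sqrt 2)⁻¹ ^ (j - p.1).natAbs := by
    intro j _
    set n := (j - p.1).natAbs with hn
    set θ := (Real.sqrt 2)⁻¹ with hθ
    have hθ0 : 0 ≤ θ := by positivity
    set M : ℝ := 2 ^ max p.1 j with hM
    have hMj : M ≤ 2 ^ n * 2 ^ j := by
      rw [hM, ← zpow_natCast, ← zpow_add₀ two_ne_zero]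
      exact zpow_le_zpow_right₀ one_le_two (by omega)
    have h1 := sum_poissonBump_dyCen_le (ℐ.filter (fun r => r.1 = j))
      (fun r hr => (Finset.mem_filter.1 hr).2) (dyCen p) (M := M)
      (zpow_le_zpow_right₀ one_le_two (le_max_right _ _))
    have h2 : ∑ r ∈ ℐ with r.1 = j, poissonBump (dyCen p) M (dyCen r) ≤
        2 * Real.pi * 2 ^ n := by
      have hj : (0 : ℝ) < 2 ^ j := by positivity
      refine le_of_mul_le_mul_left (h1.trans ?_) hj
      nlinarith [mul_le_mul_of_nonneg_right hMj Real.pi_pos.le]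
    calc _ ≤ ∑ r ∈ ℐ with r.1 = j, Real.pi * ((1 / 2) ^ n * θ ^ n) *
          poissonBump (dyCen p) M (dyCen r) := by
          refine Finset.sum_le_sum fun r hr => ?_
          obtain ⟨hr', rfl⟩ := Finset.mem_filter.1 hr
          exact (hψ p hp).norm_gram_le (hψ r hr')
      _ ≤ Real.pi * ((1 / 2) ^ n * θ ^ n) * (2 * Real.pi * 2 ^ n) := by
          rw [← Finset.mul_sum]; gcongr
      _ = 2 * Real.pi ^ 2 * θ ^ n * ((1 / 2) ^ n * 2 ^ n) := by ring
      _ = 2 * Real.pi ^ 2 * θ ^ n := by rw [← mul_pow]; norm_num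
  refine (Finset.sum_le_sum key).trans ?_
  rw [← Finset.mul_sum, besselConst]
  gcongr
  exact sum_pow_natAbs_sub_le (by positivity) inv_sqrt_two_lt_one _ _

lemma inner_toLp_eq_integral {φ g : ℝ → ℂ} (hφ : MemLp φ 2) (hg : MemLp g 2) :
    inner ℂ (hφ.toLp φ) (hg.toLp g) = ∫ x, g x * (starRingEnd ℂ) (φ x) := by
  rw [L2.inner_def]
  refine integral_congr_ae ?_
  filter_upwards [hφ.coeFn_toLp, hg.coeFn_toLp] with x h1 h2
  rw [h1, h2, RCLike.inner_apply]

lemma sum_norm_coeff_sq_le {ℐ : Finset (ℤ × ℤ)} {ψ : ℤ × ℤ → ℝ → ℂ}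
    (hψ : ∀ p ∈ ℐ, IsAdaptedBump p (ψ p)) {g : ℝ → ℂ} (hg : MemLp g 2) :
    ∑ p ∈ ℐ, ‖∫ x, g x * (starRingEnd ℂ) (ψ p x)‖ ^ 2 ≤ besselConst * ∫ x, ‖g x‖ ^ 2 := by
  have h := sum_norm_inner_sq_le_of_gram ℐ.attach
    (fun p => (hψ p.1 p.2).memLp_two.toLp (ψ p.1)) besselConst_pos.le ?_ (hg.toLp g)
  · simp only [inner_toLp_eq_integral] at h
    rw [Finset.sum_attach ℐ (fun p => ‖∫ x, g x * (starRingEnd ℂ) (ψ p x)‖ ^ 2)] at h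
    refine h.trans_eq ?_
    have e : ((‖hg.toLp g‖ ^ 2 : ℝ) : ℂ) = ((∫ x, ‖g x‖ ^ 2 : ℝ) : ℂ) := by
      have := inner_self_eq_norm_sq_to_K (𝕜 := ℂ) (hg.toLp g)
      rw [inner_toLp_eq_integral] at this
      rw [← integral_complex_ofReal]
      simp only [Complex.mul_conj'] at this
      push_cast at this ⊢
      exact this.symm
    rw [Complex.ofReal_injective e]
  · intro p _
    simp only [inner_toLp_eq_integral]
    rw [Finset.sum_attach ℐ (fun r => ‖∫ x, ψ r x * (starRingEnd ℂ) (ψ p x)‖)]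
    simp only [fun r => norm_integral_conj_comm (ψ r) (ψ p)]
    exact sum_norm_gram_le hψ p.2

/-! ### The Calderón–Zygmund decomposition -/

/-- The maximal dyadic intervals on which `‖f‖` has average larger than `l`. -/
def czFamily (f : ℝ → ℂ) (l : ℝ) : Set (ℤ × ℤ) :=
  {p | l * dyLen p < ∫ y in dyadicI p, ‖f y‖ ∧
    ∀ q, l * dyLen q < ∫ y in dyadicI q, ‖f y‖ → (dyadicI p ∩ dyadicI q).Nonempty → q.1 ≤ p.1}

/-- The union of the Calderón–Zygmund intervals. -/
def czSet (f : ℝ → ℂ) (l : ℝ) : Set ℝ := ⋃ p : czFamily f l, dyadicI p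

/-- The bounded part of the Calderón–Zygmund decomposition: `f` is replaced by its average on each
Calderón–Zygmund interval. -/
noncomputable def czGood (f : ℝ → ℂ) (l : ℝ) (x : ℝ) : ℂ :=
  open Classical in
  if h : ∃ p ∈ czFamily f l, x ∈ dyadicI p then ⨍ y in dyadicI h.choose, f y else f x

section CalderonZygmund

variable {f : ℝ → ℂ} {l : ℝ}

lemma czFamily_eq_of_mem {p q : ℤ × ℤ} (hp : p ∈ czFamily f l) (hq : q ∈ czFamily f l) {x : ℝ}
    (hxp : x ∈ dyadicI p) (hxq : x ∈ dyadicI q) : p = q :=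
  eq_of_mem_dyadicI hxp hxq
    (le_antisymm (hq.2 p hp.1 ⟨x, hxq, hxp⟩) (hp.2 q hq.1 ⟨x, hxp, hxq⟩))

lemma pairwise_disjoint_czFamily :
    Pairwise (Function.onFun Disjoint fun p : czFamily f l => dyadicI p) := fun p q hne =>
  Set.disjoint_left.2 fun _ hx hx' => hne (Subtype.ext (czFamily_eq_of_mem p.2 q.2 hx hx'))

lemma measurableSet_czSet : MeasurableSet (czSet f l) :=
  MeasurableSet.iUnion fun p => measurableSet_dyadicI p

lemma setLIntegral_czSet (g : ℝ → ℝ≥0∞) :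
    ∫⁻ x in czSet f l, g x = ∑' p : czFamily f l, ∫⁻ x in dyadicI p, g x :=
  lintegral_iUnion (s := fun p : czFamily f l => dyadicI p)
    (fun p => measurableSet_dyadicI p) pairwise_disjoint_czFamily g

lemma setIntegral_norm_le_of_mem_czFamily (hf : Integrable f) {p : ℤ × ℤ}
    (hp : p ∈ czFamily f l) : ∫ y in dyadicI p, ‖f y‖ ≤ 2 * l * dyLen p := by
  have hx : (2 : ℝ) ^ p.1 * p.2 ∈ dyadicI p := by
    have : (0 : ℝ) < 2 ^ p.1 := by positivity
    exact ⟨le_rfl, by nlinarith⟩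
  set x : ℝ := 2 ^ p.1 * p.2
  set q : ℤ × ℤ := (p.1 + 1, ⌊x / 2 ^ (p.1 + 1)⌋) with hq
  have hxq : x ∈ dyadicI q := mem_dyadicI_iff.2 rfl
  have hnot : ¬ l * dyLen q < ∫ y in dyadicI q, ‖f y‖ := fun h => by
    have := hp.2 q h ⟨x, hx, hxq⟩
    simp [hq] at this
  have hlen : dyLen q = 2 * dyLen p := by
    rw [dyLen, dyLen, hq, zpow_add_one₀ two_ne_zero, mul_comm]
  calc _ ≤ ∫ y in dyadicI q, ‖f y‖ :=
        setIntegral_mono_set hf.norm.integrableOn (ae_of_all _ fun _ => norm_nonneg _)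
          (dyadicI_subset_of_mem hx hxq (by simp [hq])).eventuallyLE
    _ ≤ l * dyLen q := not_lt.1 hnot
    _ = _ := by rw [hlen]; ring

lemma mem_czSet_of_lt (hf : Integrable f) (hl : 0 < l) {p : ℤ × ℤ} {x : ℝ} (hx : x ∈ dyadicI p)
    (hp : l * dyLen p < ∫ y in dyadicI p, ‖f y‖) : x ∈ czSet f l := by
  set D : ℤ → ℤ × ℤ := fun j => (j, ⌊x / 2 ^ j⌋) with hD
  have hDx : ∀ j, x ∈ dyadicI (D j) := fun j => mem_dyadicI_iff.2 rfl
  have hbdd : ∃ b, ∀ j, l * dyLen (D j) < ∫ y in dyadicI (D j), ‖f y‖ → j ≤ b := by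
    obtain ⟨n, hn⟩ := pow_unbounded_of_one_lt ((∫ y, ‖f y‖) / l) (one_lt_two (α := ℝ))
    refine ⟨n, fun j hj => ?_⟩
    have h1 : l * 2 ^ j < ∫ y, ‖f y‖ := hj.trans_le
      (setIntegral_le_integral hf.norm (ae_of_all _ fun _ => norm_nonneg _))
    rw [div_lt_iff₀ hl] at hn
    have h2 : (2 : ℝ) ^ j < 2 ^ (n : ℤ) := by
      rw [zpow_natCast]
      refine lt_of_mul_lt_mul_left (h1.trans ?_) hl.le
      linarith
    exact ((zpow_lt_zpow_iff_right₀ one_lt_two).1 h2).le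
  obtain ⟨m, hm1, hm2⟩ := Int.exists_greatest_of_bdd hbdd
    ⟨p.1, by rwa [eq_of_mem_dyadicI (hDx p.1) hx rfl]⟩
  refine Set.mem_iUnion.2 ⟨⟨D m, hm1, fun q hq ⟨z, hz1, hz2⟩ => ?_⟩, hDx m⟩
  by_contra! hlt
  have hxq : x ∈ dyadicI q := dyadicI_subset_of_mem hz1 hz2 hlt.le (hDx m)
  have hqD : D q.1 = q := eq_of_mem_dyadicI (hDx q.1) hxq rfl
  exact absurd (hm2 q.1 (by rwa [hqD])) (not_le.2 hlt)

lemma dyadicI_ae_eq_closedBall (p : ℤ × ℤ) :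
    (Metric.closedBall (dyCen p) (dyLen p / 2) : Set ℝ) =ᵐ[volume] dyadicI p := by
  rw [Real.closedBall_eq_Icc]
  have h1 : dyCen p - dyLen p / 2 = 2 ^ p.1 * p.2 := by unfold dyCen dyLen; ring
  have h2 : dyCen p + dyLen p / 2 = 2 ^ p.1 * (p.2 + 1) := by unfold dyCen dyLen; ring
  rw [h1, h2]
  exact Ico_ae_eq_Icc.symm

lemma ae_norm_le_of_notMem_czSet (hf : Integrable f) (hl : 0 < l) :
    ∀ᵐ x, x ∉ czSet f l → ‖f x‖ ≤ l := by
  filter_upwards [IsUnifLocDoublingMeasure.ae_tendsto_average volume hf.norm.locallyIntegrable 1]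
    with x hx hxn
  set D : ℕ → ℤ × ℤ := fun n => (-(n : ℤ), ⌊x / 2 ^ (-(n : ℤ))⌋) with hD
  have hDx : ∀ j, x ∈ dyadicI (D j) := fun j => mem_dyadicI_iff.2 rfl
  have hlen : ∀ n, dyLen (D n) / 2 = (1 / 2) ^ n / 2 := fun n => by simp [dyLen, hD]
  have ht := hx (l := Filter.atTop) (fun n => dyCen (D n)) (fun n => dyLen (D n) / 2) ?_ ?_
  · refine le_of_tendsto ht (Filter.Eventually.of_forall fun n => ?_)
    rw [setAverage_congr (dyadicI_ae_eq_closedBall (D n)), setAverage_eq, volume_real_dyadicI,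
      smul_eq_mul, inv_mul_le_iff₀ (dyLen_pos _), mul_comm]
    exact not_lt.1 fun h => hxn (mem_czSet_of_lt hf hl (hDx n) h)
  · rw [tendsto_nhdsWithin_iff]
    refine ⟨?_, Filter.Eventually.of_forall fun n => half_pos (dyLen_pos _)⟩
    simp only [hlen]
    have := (tendsto_pow_atTop_nhds_zero_of_lt_one (r := (1 / 2 : ℝ)) (by norm_num)
      (by norm_num)).div_const 2
    simpa using this
  · refine Filter.Eventually.of_forall fun n => ?_
    rw [Metric.mem_closedBall, Real.dist_eq, one_mul]
    exact abs_sub_dyCen_le (hDx n)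

lemma czGood_of_mem {p : ℤ × ℤ} (hp : p ∈ czFamily f l) {x : ℝ} (hx : x ∈ dyadicI p) :
    czGood f l x = ⨍ y in dyadicI p, f y := by
  have h : ∃ p ∈ czFamily f l, x ∈ dyadicI p := ⟨p, hp, hx⟩
  rw [czGood, dif_pos h, czFamily_eq_of_mem h.choose_spec.1 hp h.choose_spec.2 hx]

lemma czGood_of_notMem {x : ℝ} (hx : x ∉ czSet f l) : czGood f l x = f x := by
  rw [czGood, dif_neg]
  rintro ⟨p, hp, h⟩
  exact hx (Set.mem_iUnion.2 ⟨⟨p, hp⟩, h⟩)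

lemma aestronglyMeasurable_czGood (hf : Integrable f) :
    AEStronglyMeasurable (czGood f l) volume := by
  rw [← Measure.restrict_univ (μ := volume), ← Set.union_compl_self (czSet f l),
    aestronglyMeasurable_union_iff]
  constructor
  · rw [czSet, aestronglyMeasurable_iUnion_iff]
    intro p
    exact aestronglyMeasurable_const.congr (Filter.EventuallyEq.symm
      (ae_restrict_of_forall_mem (measurableSet_dyadicI p) fun x hx => czGood_of_mem p.2 hx))
  · exact hf.aestronglyMeasurable.restrict.congr (Filter.EventuallyEq.symm
      (ae_restrict_of_forall_mem measurableSet_czSet.compl fun x hx => czGood_of_notMem hx))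

lemma norm_setAverage_dyadicI_le (p : ℤ × ℤ) :
    ‖⨍ y in dyadicI p, f y‖ ≤ (dyLen p)⁻¹ * ∫ y in dyadicI p, ‖f y‖ := by
  rw [setAverage_eq, volume_real_dyadicI, norm_smul, Real.norm_of_nonneg
    (inv_nonneg.2 (dyLen_pos p).le)]
  exact mul_le_mul_of_nonneg_left (norm_integral_le_integral_norm _)
    (inv_nonneg.2 (dyLen_pos p).le)

lemma ae_norm_czGood_le (hf : Integrable f) (hl : 0 < l) : ∀ᵐ x, ‖czGood f l x‖ ≤ 2 * l := by
  filter_upwards [ae_norm_le_of_notMem_czSet hf hl] with x hx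
  by_cases h : x ∈ czSet f l
  · obtain ⟨p, hp⟩ := Set.mem_iUnion.1 h
    rw [czGood_of_mem p.2 hp]
    refine (norm_setAverage_dyadicI_le _).trans ?_
    rw [inv_mul_le_iff₀ (dyLen_pos _), mul_comm]
    exact setIntegral_norm_le_of_mem_czFamily hf p.2
  · rw [czGood_of_notMem h]
    linarith [hx h]

lemma setLIntegral_czGood_le (hf : Integrable f) (p : czFamily f l) :
    ∫⁻ x in dyadicI p, ‖czGood f l x‖ₑ ≤ ∫⁻ x in dyadicI p, ‖f x‖ₑ := by
  rw [setLIntegral_congr_fun (measurableSet_dyadicI p)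
    (fun x hx => by rw [czGood_of_mem p.2 hx]), setLIntegral_const, volume_dyadicI,
    ← ofReal_integral_norm_eq_lintegral_enorm hf.integrableOn, ← ofReal_norm,
    ← ENNReal.ofReal_mul (norm_nonneg _)]
  refine ENNReal.ofReal_le_ofReal ?_
  rw [mul_comm, ← le_inv_mul_iff₀ (dyLen_pos _)]
  exact norm_setAverage_dyadicI_le _

lemma lintegral_czGood_le (hf : Integrable f) :
    ∫⁻ x, ‖czGood f l x‖ₑ ≤ ∫⁻ x, ‖f x‖ₑ := by
  rw [← lintegral_add_compl _ (measurableSet_czSet (f := f) (l := l)),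
    ← lintegral_add_compl (fun x => ‖f x‖ₑ) (measurableSet_czSet (f := f) (l := l))]
  refine add_le_add ?_ (le_of_eq (setLIntegral_congr_fun measurableSet_czSet.compl
    fun x hx => by rw [czGood_of_notMem hx]))
  rw [setLIntegral_czSet, setLIntegral_czSet]
  exact ENNReal.tsum_le_tsum fun p => setLIntegral_czGood_le hf p

lemma integrable_czGood (hf : Integrable f) : Integrable (czGood f l) :=
  ⟨aestronglyMeasurable_czGood hf, (lintegral_czGood_le hf).trans_lt hf.2⟩

lemma integral_norm_czGood_le (hf : Integrable f) :
    ∫ x, ‖czGood f l x‖ ≤ ∫ x, ‖f x‖ := by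
  rw [← ENNReal.ofReal_le_ofReal_iff (integral_nonneg fun _ => norm_nonneg _),
    ofReal_integral_norm_eq_lintegral_enorm hf,
    ofReal_integral_norm_eq_lintegral_enorm (integrable_czGood hf)]
  exact lintegral_czGood_le hf

lemma memLp_two_czGood (hf : Integrable f) (hl : 0 < l) : MemLp (czGood f l) 2 := by
  have hm := aestronglyMeasurable_czGood (l := l) hf
  rw [memLp_two_iff_integrable_sq_norm hm]
  refine ((integrable_czGood (l := l) hf).norm.const_mul (2 * l)).mono'
    (by fun_prop) ?_
  filter_upwards [ae_norm_czGood_le hf hl] with x hx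
  rw [Real.norm_of_nonneg (by positivity), sq]
  gcongr

lemma integral_norm_sq_czGood_le (hf : Integrable f) (hl : 0 < l) :
    ∫ x, ‖czGood f l x‖ ^ 2 ≤ 2 * l * ∫ x, ‖f x‖ := by
  refine le_trans ?_ (mul_le_mul_of_nonneg_left (integral_norm_czGood_le (l := l) hf)
    (by positivity))
  rw [← integral_const_mul]
  refine integral_mono_ae ((memLp_two_iff_integrable_sq_norm
    (aestronglyMeasurable_czGood hf)).1 (memLp_two_czGood hf hl))
    ((integrable_czGood hf).norm.const_mul _) ?_
  filter_upwards [ae_norm_czGood_le hf hl] with x hx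
  rw [sq]
  gcongr

lemma setIntegral_sub_czGood (hf : Integrable f) (p : czFamily f l) :
    ∫ x in dyadicI p, (f x - czGood f l x) = 0 := by
  rw [integral_sub hf.integrableOn (integrable_czGood hf).integrableOn,
    setIntegral_congr_fun (measurableSet_dyadicI p) (fun x hx => czGood_of_mem p.2 hx),
    setIntegral_const, volume_real_dyadicI, setAverage_eq, volume_real_dyadicI, smul_smul,
    mul_inv_cancel₀ (dyLen_pos _).ne', one_smul, sub_self]

lemma setLIntegral_sub_czGood_le (hf : Integrable f) (p : czFamily f l) :
    ∫⁻ x in dyadicI p, ‖f x - czGood f l x‖ₑ ≤ 2 * ∫⁻ x in dyadicI p, ‖f x‖ₑ := by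
  calc _ ≤ ∫⁻ x in dyadicI p, (‖f x‖ₑ + ‖czGood f l x‖ₑ) :=
        lintegral_mono fun x => enorm_sub_le
    _ = (∫⁻ x in dyadicI p, ‖f x‖ₑ) + ∫⁻ x in dyadicI p, ‖czGood f l x‖ₑ :=
        lintegral_add_left' hf.aestronglyMeasurable.restrict.enorm _
    _ ≤ _ := by rw [two_mul]; exact add_le_add le_rfl (setLIntegral_czGood_le hf p)

lemma tsum_setLIntegral_le (f : ℝ → ℂ) (l : ℝ) :
    ∑' p : czFamily f l, ∫⁻ x in dyadicI p, ‖f x‖ₑ ≤ ∫⁻ x, ‖f x‖ₑ := by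
  rw [← setLIntegral_czSet]
  exact setLIntegral_le_lintegral _ _

end CalderonZygmund

/-! ### The bad part of the decomposition -/

lemma IsAdaptedBump.norm_sub_dyCen_le {p q : ℤ × ℤ} {φ : ℝ → ℂ} (h : IsAdaptedBump p φ)
    {x y : ℝ} (hx : x ∈ dyadicI p) (hy : y ∈ dyadicI q)
    (hd : 3 / 2 * dyLen q ≤ |x - dyCen q|) :
    (Real.sqrt (dyLen p))⁻¹ * ‖φ y - φ (dyCen q)‖ ≤
      4 * dyLen q * ((dyLen p ^ 2)⁻¹ * ((1 + |x - dyCen q| / dyLen p) ^ 3)⁻¹) := by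
  have hp := dyLen_pos p
  have hq := dyLen_pos q
  have hyq := abs_sub_dyCen_le hy
  have hxp := abs_sub_dyCen_le hx
  have key := h.norm_sub_le_of_forall_mem_uIcc (a := dyCen q) (x := y)
    (B := 8 * ((1 + |x - dyCen q| / dyLen p) ^ 3)⁻¹) fun z hz => ?_
  · have hs := Real.mul_self_sqrt hp.le
    have hs0 : 0 < Real.sqrt (dyLen p) := Real.sqrt_pos.2 hp
    have e : (Real.sqrt (dyLen p))⁻¹ * (dyLen p * Real.sqrt (dyLen p))⁻¹ = (dyLen p ^ 2)⁻¹ := by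
      rw [← mul_inv, mul_left_comm, hs, sq]
    calc _ ≤ (Real.sqrt (dyLen p))⁻¹ * ((dyLen p * Real.sqrt (dyLen p))⁻¹ *
          (8 * ((1 + |x - dyCen q| / dyLen p) ^ 3)⁻¹) * (dyLen q / 2)) := by
          gcongr; exact key.trans (by gcongr)
      _ = ((Real.sqrt (dyLen p))⁻¹ * (dyLen p * Real.sqrt (dyLen p))⁻¹) *
          (4 * dyLen q * ((1 + |x - dyCen q| / dyLen p) ^ 3)⁻¹) := by ring
      _ = _ := by rw [e]; ring
  · have hz' : |z - dyCen q| ≤ |y - dyCen q| := Set.abs_sub_left_of_mem_uIcc hz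
    have t1 : |x - dyCen q| ≤ |x - dyCen p| + |z - dyCen p| + |z - dyCen q| := by
      have := abs_sub_le x (dyCen p) (dyCen q)
      have := abs_sub_le (dyCen p) z (dyCen q)
      rw [abs_sub_comm (dyCen p) z] at this
      linarith
    have t2 : |x - dyCen q| / dyLen p ≤ 3 / 4 + 3 / 2 * (|z - dyCen p| / dyLen p) := by
      rw [div_le_iff₀ hp]
      have : (3 / 4 + 3 / 2 * (|z - dyCen p| / dyLen p)) * dyLen p =
          3 / 4 * dyLen p + 3 / 2 * |z - dyCen p| := by field_simp
      rw [this]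
      linarith
    set D := |x - dyCen q| / dyLen p
    set E := |z - dyCen p| / dyLen p with hE
    have E0 : 0 ≤ E := by positivity
    have D0 : 0 ≤ D := by positivity
    calc ((1 + E) ^ 10)⁻¹ ≤ ((1 + E) ^ 3)⁻¹ := by
          gcongr
          · linarith
          · norm_num
      _ ≤ (((1 + D) / 2) ^ 3)⁻¹ := by gcongr; linarith
      _ = _ := by rw [div_pow, inv_div, div_eq_mul_inv]; norm_num

lemma sum_norm_sub_dyCen_le {ℐ : Finset (ℤ × ℤ)} {ψ : ℤ × ℤ → ℝ → ℂ}
    (hψ : ∀ p ∈ ℐ, IsAdaptedBump p (ψ p)) {q : ℤ × ℤ} {x y : ℝ} (hy : y ∈ dyadicI q)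
    (hd : 3 / 2 * dyLen q ≤ |x - dyCen q|) :
    ∑ p ∈ ℐ, (dyadicI p).indicator (fun _ => (1 : ℝ)) x * (Real.sqrt (dyLen p))⁻¹ *
      ‖ψ p y - ψ p (dyCen q)‖ ≤ 128 * (dyLen q)⁻¹ * poissonBump (dyCen q) (dyLen q) x := by
  classical
  have hq := dyLen_pos q
  set d := |x - dyCen q| with hdd
  have hd0 : 0 < d := lt_of_lt_of_le (by positivity) hd
  have h1 : ∑ p ∈ ℐ, (dyadicI p).indicator (fun _ => (1 : ℝ)) x * (Real.sqrt (dyLen p))⁻¹ *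
      ‖ψ p y - ψ p (dyCen q)‖ = ∑ p ∈ ℐ with x ∈ dyadicI p,
      (Real.sqrt (dyLen p))⁻¹ * ‖ψ p y - ψ p (dyCen q)‖ := by
    rw [Finset.sum_filter]
    refine Finset.sum_congr rfl fun p _ => ?_
    by_cases hx : x ∈ dyadicI p <;> simp [hx]
  have h2 : ∑ p ∈ ℐ with x ∈ dyadicI p, (dyLen p ^ 2)⁻¹ * ((1 + d / dyLen p) ^ 3)⁻¹ ≤
      16 * (d ^ 2)⁻¹ := by
    have hinj : Set.InjOn Prod.fst ((ℐ.filter fun p => x ∈ dyadicI p : Finset (ℤ × ℤ)) :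
        Set (ℤ × ℤ)) := by
      intro p hp r hr hpr
      exact eq_of_mem_dyadicI (Finset.mem_filter.1 hp).2 (Finset.mem_filter.1 hr).2 hpr
    have := sum_scale_decay_le ((ℐ.filter fun p => x ∈ dyadicI p).image Prod.fst) hd0
    rwa [Finset.sum_image hinj] at this
  rw [h1]
  calc _ ≤ ∑ p ∈ ℐ with x ∈ dyadicI p,
        4 * dyLen q * ((dyLen p ^ 2)⁻¹ * ((1 + d / dyLen p) ^ 3)⁻¹) := by
        refine Finset.sum_le_sum fun p hp => ?_
        rw [Finset.mem_filter] at hp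
        exact (hψ p hp.1).norm_sub_dyCen_le hp.2 hy hd
    _ ≤ 4 * dyLen q * (16 * (d ^ 2)⁻¹) := by rw [← Finset.mul_sum]; gcongr
    _ ≤ _ := by
      have e : poissonBump (dyCen q) (dyLen q) x = dyLen q ^ 2 / (dyLen q ^ 2 + d ^ 2) := by
        rw [poissonBump, hdd, sq_abs]
        field_simp
      have e2 : 128 * (dyLen q)⁻¹ * (dyLen q ^ 2 / (dyLen q ^ 2 + d ^ 2)) =
          128 * dyLen q / (dyLen q ^ 2 + d ^ 2) := by field_simp
      have e3 : 4 * dyLen q * (16 * (d ^ 2)⁻¹) = 64 * dyLen q / d ^ 2 := by ring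
      rw [e, e2, e3, div_le_div_iff₀ (by positivity) (by positivity)]
      have : dyLen q ^ 2 ≤ d ^ 2 := by gcongr; linarith
      nlinarith [mul_le_mul_of_nonneg_left this hq.le]

section BadPart

variable {f : ℝ → ℂ} {l : ℝ}

lemma enorm_integral_sub_czGood_le (hf : Integrable f) {p : ℤ × ℤ} {φ : ℝ → ℂ}
    (hφ : IsAdaptedBump p φ) :
    ‖∫ x, (f x - czGood f l x) * (starRingEnd ℂ) (φ x)‖ₑ ≤
      ∑' q : czFamily f l, ∫⁻ y in dyadicI q, ‖f y - czGood f l y‖ₑ *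
        ‖φ y - φ (dyCen q)‖ₑ := by
  have hb : Integrable (fun x => f x - czGood f l x) := hf.sub (integrable_czGood hf)
  have hc : Continuous fun x => (starRingEnd ℂ) (φ x) :=
    Complex.continuous_conj.comp hφ.contDiff.continuous
  have hi : Integrable (fun x => (f x - czGood f l x) * (starRingEnd ℂ) (φ x)) :=
    hb.mul_bdd hc.aestronglyMeasurable
      (ae_of_all _ fun x => by rw [RCLike.norm_conj]; exact hφ.norm_le_bound x)
  have h1 : ∫ x, (f x - czGood f l x) * (starRingEnd ℂ) (φ x) =
      ∑' q : czFamily f l, ∫ x in dyadicI q, (f x - czGood f l x) * (starRingEnd ℂ) (φ x) := by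
    rw [← integral_iUnion (s := fun p : czFamily f l => dyadicI p)
      (fun q => measurableSet_dyadicI q) pairwise_disjoint_czFamily hi.integrableOn]
    refine (setIntegral_eq_integral_of_forall_compl_eq_zero fun x hx => ?_).symm
    rw [czGood_of_notMem hx, sub_self, zero_mul]
  rw [h1]
  refine (enorm_tsum_le_tsum_enorm).trans (ENNReal.tsum_le_tsum fun q => ?_)
  have h2 : ∫ x in dyadicI q, (f x - czGood f l x) * (starRingEnd ℂ) (φ x) =
      ∫ x in dyadicI q, (f x - czGood f l x) * (starRingEnd ℂ) (φ x - φ (dyCen q)) := by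
    simp_rw [map_sub, mul_sub]
    rw [integral_sub hi.integrableOn (hb.integrableOn.mul_const _), integral_mul_const,
      setIntegral_sub_czGood hf q, zero_mul, sub_zero]
  rw [h2]
  refine (enorm_integral_le_lintegral_enorm _).trans (lintegral_mono fun x => ?_)
  simp only [enorm_mul, RCLike.enorm_conj, le_refl]

/-- The majorant of the square function of the bad part, away from the Calderón–Zygmund
intervals. -/
noncomputable def czMajorant (f : ℝ → ℂ) (l : ℝ) (x : ℝ) : ℝ≥0∞ :=
  ∑' q : czFamily f l, (∫⁻ y in dyadicI q, ‖f y - czGood f l y‖ₑ) *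
    ENNReal.ofReal (128 * (dyLen q)⁻¹ * poissonBump (dyCen q) (dyLen q) x)

lemma measurable_czMajorant : Measurable (czMajorant f l) := by
  refine Measurable.tsum fun q => ?_
  have := measurable_poissonBump (dyCen q) (dyLen q)
  fun_prop

lemma lintegral_czMajorant_le (hf : Integrable f) :
    ∫⁻ x, czMajorant f l x ≤ ENNReal.ofReal (256 * Real.pi * ∫ x, ‖f x‖) := by
  have hm : ∀ q : czFamily f l, Measurable fun x =>
      ENNReal.ofReal (128 * (dyLen q)⁻¹ * poissonBump (dyCen q) (dyLen q) x) := fun q => by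
    have := measurable_poissonBump (dyCen q) (dyLen q)
    fun_prop
  have hI : ∀ q : czFamily f l,
      ∫⁻ x, ENNReal.ofReal (128 * (dyLen q)⁻¹ * poissonBump (dyCen q) (dyLen q) x) =
        ENNReal.ofReal (128 * Real.pi) := by
    intro q
    have hq := dyLen_pos q
    rw [← ofReal_integral_eq_lintegral_ofReal
      ((integrable_poissonBump _ hq).const_mul _) (ae_of_all _ fun x => ?_),
      integral_const_mul, integral_poissonBump _ hq]
    · congr 1
      field_simp
    · have := poissonBump_nonneg (dyCen q) (dyLen q) x
      simp only [Pi.zero_apply]; positivity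
  unfold czMajorant
  rw [lintegral_tsum fun q => ((hm q).const_mul _).aemeasurable]
  simp_rw [lintegral_const_mul _ (hm _), hI]
  rw [ENNReal.tsum_mul_right]
  calc _ ≤ (∑' q : czFamily f l, 2 * ∫⁻ y in dyadicI q, ‖f y‖ₑ) *
        ENNReal.ofReal (128 * Real.pi) := by
        gcongr with q; exact setLIntegral_sub_czGood_le hf q
    _ ≤ (2 * ∫⁻ y, ‖f y‖ₑ) * ENNReal.ofReal (128 * Real.pi) := by
        rw [ENNReal.tsum_mul_left]; gcongr; exact tsum_setLIntegral_le f l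
    _ = _ := by
        have h2 : (2 : ℝ≥0∞) = ENNReal.ofReal 2 := by simp
        rw [← ofReal_integral_norm_eq_lintegral_enorm hf, h2, ← ENNReal.ofReal_mul zero_le_two,
          ← ENNReal.ofReal_mul (by positivity)]
        congr 1
        ring

/-- The union of the threefold dilates of the Calderón–Zygmund intervals. -/
def czDilate (f : ℝ → ℂ) (l : ℝ) : Set ℝ :=
  ⋃ q : czFamily f l, Metric.closedBall (dyCen q) (3 / 2 * dyLen q)

lemma mul_volume_czDilate_le (hf : Integrable f) (hl : 0 < l) :
    ENNReal.ofReal l * volume (czDilate f l) ≤ ENNReal.ofReal (3 * ∫ x, ‖f x‖) := by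
  have key : ∀ q : czFamily f l,
      ENNReal.ofReal l * volume (Metric.closedBall (dyCen q) (3 / 2 * dyLen q)) ≤
        3 * ∫⁻ y in dyadicI q, ‖f y‖ₑ := by
    intro q
    rw [Real.volume_closedBall, ← ENNReal.ofReal_mul hl.le,
      ← ofReal_integral_norm_eq_lintegral_enorm hf.integrableOn,
      show (3 : ℝ≥0∞) = ENNReal.ofReal 3 by simp, ← ENNReal.ofReal_mul (by norm_num)]
    refine ENNReal.ofReal_le_ofReal ?_
    linarith [q.2.1]
  calc _ ≤ ENNReal.ofReal l *
        ∑' q : czFamily f l, volume (Metric.closedBall (dyCen q) (3 / 2 * dyLen q)) := by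
        gcongr; exact measure_iUnion_le _
    _ ≤ ∑' q : czFamily f l, 3 * ∫⁻ y in dyadicI q, ‖f y‖ₑ := by
        rw [← ENNReal.tsum_mul_left]; exact ENNReal.tsum_le_tsum key
    _ ≤ 3 * ∫⁻ y, ‖f y‖ₑ := by
        rw [ENNReal.tsum_mul_left]; gcongr; exact tsum_setLIntegral_le f l
    _ = _ := by
        rw [← ofReal_integral_norm_eq_lintegral_enorm hf,
          show (3 : ℝ≥0∞) = ENNReal.ofReal 3 by simp, ← ENNReal.ofReal_mul (by norm_num)]

lemma sum_coeff_sub_czGood_le (hf : Integrable f) {ℐ : Finset (ℤ × ℤ)} {ψ : ℤ × ℤ → ℝ → ℂ}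
    (hψ : ∀ p ∈ ℐ, IsAdaptedBump p (ψ p)) {x : ℝ} (hx : x ∉ czDilate f l) :
    ENNReal.ofReal (∑ p ∈ ℐ, (dyadicI p).indicator (fun _ => (1 : ℝ)) x *
      (Real.sqrt (dyLen p))⁻¹ * ‖∫ t, (f t - czGood f l t) * (starRingEnd ℂ) (ψ p t)‖) ≤
      czMajorant f l x := by
  set w : ℤ × ℤ → ℝ := fun p =>
    (dyadicI p).indicator (fun _ => (1 : ℝ)) x * (Real.sqrt (dyLen p))⁻¹ with hw
  have hw0 : ∀ p, 0 ≤ w p := fun p =>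
    mul_nonneg (Set.indicator_nonneg (fun _ _ => zero_le_one) _) (by positivity)
  have hb : Integrable (fun x => f x - czGood f l x) := hf.sub (integrable_czGood hf)
  rw [ENNReal.ofReal_sum_of_nonneg fun p _ => mul_nonneg (hw0 p) (norm_nonneg _)]
  calc _ ≤ ∑ p ∈ ℐ, ∑' q : czFamily f l, ENNReal.ofReal (w p) *
        ∫⁻ y in dyadicI q, ‖f y - czGood f l y‖ₑ * ‖ψ p y - ψ p (dyCen q)‖ₑ := by
        refine Finset.sum_le_sum fun p hp => ?_
        rw [ENNReal.ofReal_mul (hw0 p), ofReal_norm, ENNReal.tsum_mul_left]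
        gcongr
        exact enorm_integral_sub_czGood_le hf (hψ p hp)
    _ = ∑' q : czFamily f l, ∑ p ∈ ℐ, ENNReal.ofReal (w p) *
        ∫⁻ y in dyadicI q, ‖f y - czGood f l y‖ₑ * ‖ψ p y - ψ p (dyCen q)‖ₑ :=
        (Summable.tsum_finsetSum fun _ _ => ENNReal.summable).symm
    _ ≤ czMajorant f l x := by
        refine ENNReal.tsum_le_tsum fun q => ?_
        have hd : 3 / 2 * dyLen q ≤ |x - dyCen q| := by
          have : x ∉ Metric.closedBall (dyCen q) (3 / 2 * dyLen q) := fun h =>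
            hx (Set.mem_iUnion.2 ⟨q, h⟩)
          rw [Metric.mem_closedBall, Real.dist_eq] at this
          exact (not_le.1 this).le
        have hmeas : ∀ p ∈ ℐ, AEMeasurable (fun y => ENNReal.ofReal (w p) *
            (‖f y - czGood f l y‖ₑ * ‖ψ p y - ψ p (dyCen q)‖ₑ))
            (volume.restrict (dyadicI q)) := fun p hp => by
          have h1 := hb.aestronglyMeasurable.restrict (s := dyadicI q).enorm
          have h2 := (hψ p hp).contDiff.continuous
          have h3 : Measurable fun y => ‖ψ p y - ψ p (dyCen q)‖ₑ := by fun_prop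
          exact (h1.mul h3.aemeasurable).const_mul _
        simp_rw [← lintegral_const_mul' _ _ ENNReal.ofReal_ne_top]
        rw [← lintegral_finsetSum' _ hmeas,
          ← lintegral_mul_const' _ _ ENNReal.ofReal_ne_top]
        refine setLIntegral_mono' (measurableSet_dyadicI q) fun y hy => ?_
        simp_rw [mul_left_comm (ENNReal.ofReal (w _))]
        rw [← Finset.mul_sum]
        gcongr
        refine le_trans (le_of_eq ?_) (ENNReal.ofReal_le_ofReal (sum_norm_sub_dyCen_le hψ hy hd))
        rw [ENNReal.ofReal_sum_of_nonneg fun p _ => mul_nonneg (hw0 p) (norm_nonneg _)]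
        refine Finset.sum_congr rfl fun p _ => ?_
        rw [ENNReal.ofReal_mul (hw0 p), ofReal_norm]

end BadPart

/-! ### The weak-type estimate -/

/-- The square of the square function with coefficients `a`. -/
noncomputable def sqSum (ℐ : Finset (ℤ × ℤ)) (a : ℤ × ℤ → ℂ) (x : ℝ) : ℝ :=
  ∑ p ∈ ℐ, ‖a p‖ ^ 2 * Set.indicator (dyadicI p) (fun _ => (1 : ℝ)) x / dyLen p

section SquareFunction

variable {ℐ : Finset (ℤ × ℤ)}

lemma sqSum_nonneg (a : ℤ × ℤ → ℂ) (x : ℝ) : 0 ≤ sqSum ℐ a x :=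
  Finset.sum_nonneg fun p _ => div_nonneg (mul_nonneg (sq_nonneg _)
    (Set.indicator_nonneg (fun _ _ => zero_le_one) x)) (dyLen_pos p).le

lemma sqSum_add_le (a b : ℤ × ℤ → ℂ) (x : ℝ) :
    sqSum ℐ (fun p => a p + b p) x ≤ 2 * sqSum ℐ a x + 2 * sqSum ℐ b x := by
  simp only [sqSum, Finset.mul_sum]
  rw [← Finset.sum_add_distrib]
  refine Finset.sum_le_sum fun p _ => ?_
  have hi : 0 ≤ Set.indicator (dyadicI p) (fun _ => (1 : ℝ)) x / dyLen p :=
    div_nonneg (Set.indicator_nonneg (fun _ _ => zero_le_one) x) (dyLen_pos p).le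
  have h : ‖a p + b p‖ ^ 2 ≤ 2 * ‖a p‖ ^ 2 + 2 * ‖b p‖ ^ 2 := by
    have h1 := pow_le_pow_left₀ (norm_nonneg _) (norm_add_le (a p) (b p)) 2
    nlinarith [sq_nonneg (‖a p‖ - ‖b p‖)]
  have h2 := mul_le_mul_of_nonneg_right h hi
  simp only [mul_div_assoc]
  linarith

lemma sqSum_le_sq_sum (a : ℤ × ℤ → ℂ) (x : ℝ) :
    sqSum ℐ a x ≤ (∑ p ∈ ℐ, Set.indicator (dyadicI p) (fun _ => (1 : ℝ)) x *
      (Real.sqrt (dyLen p))⁻¹ * ‖a p‖) ^ 2 := by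
  refine le_trans (le_of_eq ?_) (Finset.sum_sq_le_sq_sum_of_nonneg fun p _ => ?_)
  · refine Finset.sum_congr rfl fun p _ => ?_
    rw [mul_pow, mul_pow, inv_pow, Real.sq_sqrt (dyLen_pos p).le]
    by_cases hx : x ∈ dyadicI p
    · simp only [Set.indicator_of_mem hx]; ring
    · simp [Set.indicator_of_notMem hx]
  · exact mul_nonneg (mul_nonneg (Set.indicator_nonneg (fun _ _ => zero_le_one) x)
      (inv_nonneg.2 (Real.sqrt_nonneg _))) (norm_nonneg _)

lemma integrable_indicator_one_dyadicI (p : ℤ × ℤ) :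
    Integrable (Set.indicator (dyadicI p) (fun _ => (1 : ℝ))) := by
  refine (integrable_indicator_iff (measurableSet_dyadicI p)).2 ?_
  exact integrableOn_const (by rw [volume_dyadicI]; exact ENNReal.ofReal_ne_top)

lemma integrable_sqSum (a : ℤ × ℤ → ℂ) : Integrable (sqSum ℐ a) :=
  integrable_finsetSum _ fun p _ =>
    ((integrable_indicator_one_dyadicI p).const_mul _).div_const _

lemma integral_sqSum (a : ℤ × ℤ → ℂ) : ∫ x, sqSum ℐ a x = ∑ p ∈ ℐ, ‖a p‖ ^ 2 := by
  simp only [sqSum]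
  rw [integral_finsetSum _ fun p _ =>
    ((integrable_indicator_one_dyadicI p).const_mul _).div_const _]
  refine Finset.sum_congr rfl fun p _ => ?_
  rw [integral_div, integral_const_mul, integral_indicator (measurableSet_dyadicI p),
    setIntegral_const, volume_real_dyadicI, smul_eq_mul, mul_one,
    mul_div_assoc, div_self (dyLen_pos p).ne', mul_one]

lemma IsAdaptedBump.integrable_mul_conj {p : ℤ × ℤ} {φ g : ℝ → ℂ} (hφ : IsAdaptedBump p φ)
    (hg : Integrable g) : Integrable fun x => g x * (starRingEnd ℂ) (φ x) :=
  hg.mul_bdd (Complex.continuous_conj.comp hφ.contDiff.continuous).aestronglyMeasurable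
    (ae_of_all _ fun x => by
      rw [RCLike.norm_conj]; exact hφ.norm_le_bound x)

variable {ψ : ℤ × ℤ → ℝ → ℂ} {f : ℝ → ℂ} {l : ℝ}

lemma sqSum_coeff_le (hf : Integrable f) (hψ : ∀ p ∈ ℐ, IsAdaptedBump p (ψ p)) (x : ℝ) :
    sqSum ℐ (fun p => ∫ t, f t * (starRingEnd ℂ) (ψ p t)) x ≤
      2 * sqSum ℐ (fun p => ∫ t, czGood f l t * (starRingEnd ℂ) (ψ p t)) x +
      2 * sqSum ℐ (fun p => ∫ t, (f t - czGood f l t) * (starRingEnd ℂ) (ψ p t)) x := by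
  refine le_trans (le_of_eq ?_) (sqSum_add_le _ _ x)
  refine Finset.sum_congr rfl fun p hp => ?_
  have h : ∫ t, f t * (starRingEnd ℂ) (ψ p t) =
      (∫ t, czGood f l t * (starRingEnd ℂ) (ψ p t)) +
      ∫ t, (f t - czGood f l t) * (starRingEnd ℂ) (ψ p t) := by
    rw [← integral_add ((hψ p hp).integrable_mul_conj (integrable_czGood (l := l) hf))
      ((hψ p hp).integrable_mul_conj (g := fun t => f t - czGood f l t)
        (hf.sub (integrable_czGood hf)))]
    refine integral_congr_ae (ae_of_all _ fun t => ?_)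
    ring
  simp only [h]

lemma superlevel_subset (hf : Integrable f) (hl : 0 < l)
    (hψ : ∀ p ∈ ℐ, IsAdaptedBump p (ψ p)) :
    {x : ℝ | l < |Real.sqrt (sqSum ℐ (fun p => ∫ t, f t * (starRingEnd ℂ) (ψ p t)) x)|} ⊆
      czDilate f l ∪
      ({x | l ^ 2 / 4 ≤ sqSum ℐ (fun p => ∫ t, czGood f l t * (starRingEnd ℂ) (ψ p t)) x} ∪
      {x | ENNReal.ofReal (l / 2) ≤ czMajorant f l x}) := by
  intro x hx
  rw [Set.mem_ofPred_eq, abs_of_nonneg (Real.sqrt_nonneg _), Real.lt_sqrt hl.le] at hx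
  by_cases hd : x ∈ czDilate f l
  · exact Or.inl hd
  refine Or.inr ?_
  by_cases hg : l ^ 2 / 4 ≤ sqSum ℐ (fun p => ∫ t, czGood f l t * (starRingEnd ℂ) (ψ p t)) x
  · exact Or.inl hg
  refine Or.inr (le_trans (ENNReal.ofReal_le_ofReal ?_) (sum_coeff_sub_czGood_le hf hψ hd))
  have h1 := sqSum_coeff_le (l := l) hf hψ x
  have h2 := sqSum_le_sq_sum (ℐ := ℐ)
    (fun p => ∫ t, (f t - czGood f l t) * (starRingEnd ℂ) (ψ p t)) x
  refine le_of_sq_le_sq ?_ ?_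
  · push Not at hg
    refine le_trans ?_ h2
    nlinarith
  · exact Finset.sum_nonneg fun p _ =>
      mul_nonneg (mul_nonneg (Set.indicator_nonneg (fun _ _ => zero_le_one) x)
      (inv_nonneg.2 (Real.sqrt_nonneg _))) (norm_nonneg _)

lemma mul_volume_sqSum_czGood_ge_le (hf : Integrable f) (hl : 0 < l)
    (hψ : ∀ p ∈ ℐ, IsAdaptedBump p (ψ p)) :
    ENNReal.ofReal l * volume
      {x | l ^ 2 / 4 ≤ sqSum ℐ (fun p => ∫ t, czGood f l t * (starRingEnd ℂ) (ψ p t)) x} ≤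
      ENNReal.ofReal (8 * besselConst * ∫ x, ‖f x‖) := by
  set a : ℤ × ℤ → ℂ := fun p => ∫ t, czGood f l t * (starRingEnd ℂ) (ψ p t)
  have hi := integrable_sqSum (ℐ := ℐ) a
  have hsub : {x | l ^ 2 / 4 ≤ sqSum ℐ a x} =
      {x | ENNReal.ofReal (l ^ 2 / 4) ≤ ENNReal.ofReal (sqSum ℐ a x)} := by
    ext x; exact (ENNReal.ofReal_le_ofReal_iff (sqSum_nonneg a x)).symm
  have h1 := mul_meas_ge_le_lintegral₀ (μ := volume)
    hi.aestronglyMeasurable.aemeasurable.ennreal_ofReal (ENNReal.ofReal (l ^ 2 / 4))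
  rw [← hsub, ← ofReal_integral_eq_lintegral_ofReal hi (ae_of_all _ (sqSum_nonneg a)),
    integral_sqSum] at h1
  have h2 : ∑ p ∈ ℐ, ‖a p‖ ^ 2 ≤ besselConst * (2 * l * ∫ x, ‖f x‖) :=
    (sum_norm_coeff_sq_le hψ (memLp_two_czGood hf hl)).trans
      (mul_le_mul_of_nonneg_left (integral_norm_sq_czGood_le hf hl) besselConst_pos.le)
  calc ENNReal.ofReal l * volume {x | l ^ 2 / 4 ≤ sqSum ℐ a x}
      = ENNReal.ofReal (4 / l) *
        (ENNReal.ofReal (l ^ 2 / 4) * volume {x | l ^ 2 / 4 ≤ sqSum ℐ a x}) := by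
        rw [← mul_assoc, ← ENNReal.ofReal_mul (by positivity)]
        congr 2
        field_simp
    _ ≤ ENNReal.ofReal (4 / l) * ENNReal.ofReal (besselConst * (2 * l * ∫ x, ‖f x‖)) := by
        gcongr
        exact h1.trans (ENNReal.ofReal_le_ofReal h2)
    _ = ENNReal.ofReal (8 * besselConst * ∫ x, ‖f x‖) := by
        rw [← ENNReal.ofReal_mul (by positivity)]
        congr 1
        field_simp
        ring

lemma mul_volume_czMajorant_ge_le (hf : Integrable f) :
    ENNReal.ofReal l * volume {x | ENNReal.ofReal (l / 2) ≤ czMajorant f l x} ≤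
      ENNReal.ofReal (512 * Real.pi * ∫ x, ‖f x‖) := by
  have h1 := (mul_meas_ge_le_lintegral₀ (μ := volume)
    measurable_czMajorant.aemeasurable (ENNReal.ofReal (l / 2))).trans
    (lintegral_czMajorant_le (l := l) hf)
  calc ENNReal.ofReal l * volume {x | ENNReal.ofReal (l / 2) ≤ czMajorant f l x}
      = ENNReal.ofReal 2 * (ENNReal.ofReal (l / 2) *
        volume {x | ENNReal.ofReal (l / 2) ≤ czMajorant f l x}) := by
        rw [← mul_assoc, ← ENNReal.ofReal_mul (by positivity)]
        congr 2
        ring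
    _ ≤ ENNReal.ofReal 2 * ENNReal.ofReal (256 * Real.pi * ∫ x, ‖f x‖) := by gcongr
    _ = ENNReal.ofReal (512 * Real.pi * ∫ x, ‖f x‖) := by
        rw [← ENNReal.ofReal_mul (by positivity)]
        congr 1
        ring

end SquareFunction

/-- Weak-type `(1,1)` bound for the square function of coefficients against
`L²`-normalized mean-zero bumps adapted to a finite family of dyadic
intervals. -/
theorem weak_L1_square_function_bound :
    ∃ C : ℝ, 0 < C ∧
      ∀ (ℐ : Finset (ℤ × ℤ)) (ψ : ℤ × ℤ → ℝ → ℂ),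
        (∀ p ∈ ℐ, ContDiff ℝ 1 (ψ p)) →
        (∀ p ∈ ℐ, ∫ x : ℝ, ψ p x = 0) →
        (∀ p ∈ ℐ, ∀ x : ℝ, ‖ψ p x‖ ≤
          (Real.sqrt (dyLen p))⁻¹ * ((1 + |x - dyCen p| / dyLen p) ^ 10)⁻¹) →
        (∀ p ∈ ℐ, ∀ x : ℝ, ‖deriv (ψ p) x‖ ≤
          (dyLen p * Real.sqrt (dyLen p))⁻¹ * ((1 + |x - dyCen p| / dyLen p) ^ 10)⁻¹) →
        ∀ f : ℝ → ℂ, Integrable f volume →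
          weakL1 (fun x => Real.sqrt (∑ p ∈ ℐ,
              ‖∫ t : ℝ, f t * (starRingEnd ℂ) (ψ p t)‖ ^ 2 *
                Set.indicator (dyadicI p) (fun _ => (1 : ℝ)) x / dyLen p))
            ≤ ENNReal.ofReal (C * ∫ x : ℝ, ‖f x‖) := by
  have hπ := Real.pi_pos
  have hB := besselConst_pos
  refine ⟨3 + 8 * besselConst + 512 * Real.pi, by positivity, ?_⟩
  intro ℐ ψ h1 h2 h3 h4 f hf
  have hψ : ∀ p ∈ ℐ, IsAdaptedBump p (ψ p) := fun p hp => ⟨h1 p hp, h2 p hp, h3 p hp, h4 p hp⟩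
  refine iSup₂_le fun l hl => ?_
  have hF : 0 ≤ ∫ x, ‖f x‖ := integral_nonneg fun x => norm_nonneg _
  calc _ ≤ ENNReal.ofReal l * (volume (czDilate f l) +
        (volume {x | l ^ 2 / 4 ≤
          sqSum ℐ (fun p => ∫ t, czGood f l t * (starRingEnd ℂ) (ψ p t)) x} +
        volume {x | ENNReal.ofReal (l / 2) ≤ czMajorant f l x})) := by
        gcongr
        refine (measure_mono (superlevel_subset hf hl hψ)).trans ?_
        refine (measure_union_le _ _).trans ?_
        gcongr
        exact measure_union_le _ _
    _ ≤ ENNReal.ofReal (3 * ∫ x, ‖f x‖) + (ENNReal.ofReal (8 * besselConst * ∫ x, ‖f x‖) +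
        ENNReal.ofReal (512 * Real.pi * ∫ x, ‖f x‖)) := by
        rw [mul_add, mul_add]
        gcongr
        · exact mul_volume_czDilate_le hf hl
        · exact mul_volume_sqSum_czGood_ge_le hf hl hψ
        · exact mul_volume_czMajorant_ge_le hf
    _ = ENNReal.ofReal ((3 + 8 * besselConst + 512 * Real.pi) * ∫ x, ‖f x‖) := by
        rw [← ENNReal.ofReal_add (by positivity) (by positivity),
          ← ENNReal.ofReal_add (by positivity) (by positivity)]
        congr 1
        ring
end
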